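/- arXiv:2002.07248 — 9 statements merged into one kernel-verified Lean document; each statement's English description precedes it below -/
import Mathlib

section
/- There exists a constant ε > 0 such that for every C5-free tournament T on n ≥ 2 vertices there exist disjoint vertex subsets A and B of V(T) with |A| ≥ ε·n and |B| ≥ ε·n such that A is complete to B. (That is, the class of C5-free tournaments has the strong Erdős–Hajnal property.) -/
/-- The tournament `C₅` on `Fin 5`: `i → i+1` and `i → i+2` (mod 5). -/
def C5 (i j : Fin 5) : Prop := j = i + 1 ∨ j = i + 2

section

open scoped Classical

/-- A relation is a tournament if it is irreflexive and orients every pair of distinct vertices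
in exactly one way. -/
structure IsTournament {V : Type*} (E : V → V → Prop) : Prop where
  irrefl : ∀ v, ¬ E v v
  iff_not : ∀ u v, u ≠ v → (E u v ↔ ¬ E v u)

/-- A relation is `C₅`-free if it contains no copy of `C₅`. -/
def C5Free {V : Type*} (E : V → V → Prop) : Prop :=
  ¬ ∃ f : Fin 5 → V, Function.Injective f ∧ ∀ i j : Fin 5, C5 i j → E (f i) (f j)

namespace IsTournament

variable {V : Type*} {E : V → V → Prop}

theorem ne (hT : IsTournament E) {u v : V} (h : E u v) : u ≠ v := by
  rintro rfl
  exact hT.irrefl _ h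

theorem asymm (hT : IsTournament E) {u v : V} (h : E u v) : ¬ E v u :=
  (hT.iff_not u v (hT.ne h)).1 h

theorem of_not (hT : IsTournament E) {u v : V} (huv : u ≠ v) (h : ¬ E v u) : E u v :=
  (hT.iff_not u v huv).2 h

theorem flip (hT : IsTournament E) : IsTournament (flip E) :=
  ⟨hT.irrefl, fun u v huv => hT.iff_not v u huv.symm⟩

end IsTournament

theorem C5_or_C5 : ∀ i j : Fin 5, i ≠ j → C5 i j ∨ C5 j i := by
  unfold C5
  decide

theorem C5_asymm : ∀ i j : Fin 5, C5 i j → ¬ C5 j i := by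
  unfold C5
  decide

theorem C5_rev : ∀ i j : Fin 5, C5 i j → C5 j.rev i.rev := by
  unfold C5
  decide

theorem C5Free.flip {V : Type*} {E : V → V → Prop} (h : C5Free E) : C5Free (flip E) := by
  rintro ⟨f, hf, hE⟩
  exact h ⟨f ∘ Fin.rev, hf.comp Fin.rev_injective, fun i j hij => hE _ _ (C5_rev i j hij)⟩

theorem IsTournament.injective_of_C5 {V : Type*} {E : V → V → Prop} (hT : IsTournament E)
    {f : Fin 5 → V} (hf : ∀ i j, C5 i j → E (f i) (f j)) : Function.Injective f := by
  intro i j hij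
  by_contra hne
  rcases C5_or_C5 i j hne with h | h
  · exact hT.ne (hf _ _ h) hij
  · exact hT.ne (hf _ _ h) hij.symm

theorem C5Free.false_of_path {V : Type*} {E : V → V → Prop} (hT : IsTournament E) (hE : C5Free E)
    {a a' m b b' : V} (haa' : E a a') (ham : E a m) (ha'm : E a' m) (ha'b : E a' b)
    (hmb : E m b) (hmb' : E m b') (hbb' : E b b') (hba : E b a) (hb'a : E b' a)
    (hb'a' : E b' a') : False := by
  have key : ∀ i j, C5 i j → E (![a, a', m, b, b'] i) (![a, a', m, b, b'] j) := by
    intro i j hij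
    rcases hij with rfl | rfl <;> fin_cases i <;> assumption
  exact hE ⟨_, hT.injective_of_C5 key, key⟩

/-- The bipartite graph of the arcs going from `R` back to `L`. -/
def backGraph {V : Type*} {E : V → V → Prop} (hT : IsTournament E) (L R : Finset V) :
    SimpleGraph V where
  Adj x y := (x ∈ L ∧ y ∈ R ∧ E y x) ∨ (x ∈ R ∧ y ∈ L ∧ E x y)
  symm := ⟨fun _ _ h => h.elim (fun h => Or.inr ⟨h.2.1, h.1, h.2.2⟩)
    (fun h => Or.inl ⟨h.2.1, h.1, h.2.2⟩)⟩
  loopless := ⟨fun x h => hT.irrefl x (h.elim (fun h => h.2.2) (fun h => h.2.2))⟩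

theorem backGraph_mono {V : Type*} {E : V → V → Prop} (hT : IsTournament E)
    {L L' R R' : Finset V} (hL : L ⊆ L') (hR : R ⊆ R') :
    backGraph hT L R ≤ backGraph hT L' R' := by
  intro x y h
  exact h.imp (fun h => ⟨hL h.1, hR h.2.1, h.2.2⟩) (fun h => ⟨hR h.1, hL h.2.1, h.2.2⟩)

theorem SimpleGraph.Walk.not_adj_getVert_add_three {V : Type*} {G : SimpleGraph V} {u v : V}
    (p : G.Walk u v) (hp : p.length = G.dist u v) {i : ℕ} (hi : i + 3 ≤ p.length) :
    ¬ G.Adj (p.getVert i) (p.getVert (i + 3)) := by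
  intro h
  have := G.dist_le ((p.take i).append (.cons h (p.drop (i + 3))))
  simp only [SimpleGraph.Walk.length_append, SimpleGraph.Walk.length_cons,
    SimpleGraph.Walk.take_length, SimpleGraph.Walk.drop_length] at this
  omega

/-- Along a shortest path of back arcs from `b` to `b'`, the arcs between vertices at distance two
alternate, which is impossible if both ends are complete to the other vertices of `R`. -/
theorem C5Free.false_of_reachable {V : Type*} {E : V → V → Prop} (hT : IsTournament E)
    (hE : C5Free E) {L R : Finset V} (hLR : Disjoint L R)
    (hM : ∀ a ∈ L, ∀ a' ∈ L, ∀ b ∈ R, ∀ b' ∈ R, ∃ m, E a m ∧ E a' m ∧ E m b ∧ E m b')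
    {b b' : V} (hb : b ∈ R) (hb' : b' ∈ R) (hbb' : b ≠ b')
    (hreach : (backGraph hT L R).Reachable b b')
    (hcommon : ∀ l ∈ L, E b l → ¬ E b' l)
    (hends : ∀ r ∈ R, r ≠ b → r ≠ b' → E b r ∧ E b' r) : False := by
  obtain ⟨p, hp⟩ := hreach.exists_walk_length_eq_dist
  have hpath := p.isPath_of_length_eq_dist hp
  have hinj : ∀ i j, i ≤ p.length → j ≤ p.length → p.getVert i = p.getVert j → i = j :=
    fun i j hi hj h => hpath.getVert_injOn hi hj h
  have hfar : ∀ i, i + 3 ≤ p.length → ¬ (backGraph hT L R).Adj (p.getVert i) (p.getVert (i + 3)) :=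
    fun i hi => p.not_adj_getVert_add_three hp hi
  have hadj : ∀ i, i < p.length → (backGraph hT L R).Adj (p.getVert i) (p.getVert (i + 1)) :=
    fun i hi => p.adj_getVert_succ hi
  have h0 : p.getVert 0 = b := p.getVert_zero
  have hN : p.getVert p.length = b' := p.getVert_length
  generalize p.getVert = q at *
  generalize p.length = N at *
  have hLR' : ∀ x, x ∈ L → x ∈ R → False := fun x h h' => Finset.disjoint_left.1 hLR h h'
  have hside : ∀ i, i ≤ N → (Even i → q i ∈ R) ∧ (¬ Even i → q i ∈ L) := by
    intro i
    induction i with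
    | zero => intro _; simp [h0, hb]
    | succ i ih =>
      intro hi
      have h1 := ih (by omega)
      have h2 := hadj i (by omega)
      rw [Nat.even_add_one]
      by_cases hev : Even i
      · have h3 := h1.1 hev
        rcases h2 with h2 | h2
        · exact (hLR' _ h2.1 h3).elim
        · simp [hev, h2.2.1]
      · have h3 := h1.2 hev
        rcases h2 with h2 | h2
        · simp [hev, h2.2.1]
        · exact (hLR' _ h3 h2.1).elim
  have hback : ∀ i, i < N → (Even i → E (q i) (q (i + 1))) ∧ (¬ Even i → E (q (i + 1)) (q i)) := by
    intro i hi
    have h1 := hside i hi.le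
    rcases hadj i hi with h | h
    · exact ⟨fun hev => (hLR' _ h.1 (h1.1 hev)).elim, fun _ => h.2.2⟩
    · exact ⟨fun _ => h.2.2, fun hev => (hLR' _ (h1.2 hev) h.1).elim⟩
  have hNeven : Even N := by
    by_contra h
    exact hLR' _ ((hside N le_rfl).2 h) (hN ▸ hb')
  have hN0 : N ≠ 0 := by
    rintro rfl
    exact hbb' (h0.symm.trans hN)
  have hN2 : N ≠ 2 := by
    rintro rfl
    refine hcommon (q 1) ((hside 1 (by omega)).2 (by decide)) ?_ ?_
    · exact h0 ▸ (hback 0 (by omega)).1 (by decide)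
    · exact hN ▸ (hback 1 (by omega)).2 (by decide)
  have hN4 : 4 ≤ N := by
    obtain ⟨k, rfl⟩ := hNeven
    omega
  have hforw : ∀ i, i + 2 ≤ N →
      (Even i → E (q i) (q (i + 2))) ∧ (¬ Even i → E (q (i + 2)) (q i)) := by
    intro i
    induction i with
    | zero =>
      intro _
      have h2 : q 2 ∈ R := (hside 2 (by omega)).1 (by decide)
      have := hends (q 2) h2
        (fun h => by have := hinj 2 0 (by omega) (by omega) (h.trans h0.symm); omega)
        (fun h => by have := hinj 2 N (by omega) (by omega) (h.trans hN.symm); omega)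
      simp only [Nat.zero_add, h0]
      exact ⟨fun _ => this.1, fun h => (h (by decide)).elim⟩
    | succ i ih =>
      intro hi
      have h1 := ih (by omega)
      have hne : q (i + 1) ≠ q (i + 1 + 2) := fun h => by
        have := hinj (i + 1) (i + 1 + 2) (by omega) (by omega) h
        omega
      have hf := hfar i (by omega)
      have s0 := hside i (by omega)
      have s1 := hside (i + 1) (by omega)
      have s2 := hside (i + 2) (by omega)
      have s3 := hside (i + 3) (by omega)
      have b0 := hback i (by omega)
      have b1 := hback (i + 1) (by omega)
      have b2 := hback (i + 2) (by omega)
      by_cases hev : Even i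
      · simp only [Nat.even_add_one, hev, not_true, not_false_iff, forall_true_left,
          false_imp_iff, true_and, and_true] at *
        by_contra hcon
        obtain ⟨m, hm⟩ := hM _ s1 _ s3 _ s0 _ s2
        refine hE.false_of_path hT (hT.of_not hne hcon) hm.1 hm.2.1 ?_ hm.2.2.1 hm.2.2.2 h1 b0 b1 b2
        refine hT.of_not ?_ fun h => hf (Or.inr ⟨s0, s3, h⟩)
        exact fun h => hLR' _ s3 (h ▸ s0)
      · simp only [Nat.even_add_one, hev, not_true, not_false_iff, forall_true_left,
          false_imp_iff, true_and, and_true] at *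
        by_contra hcon
        obtain ⟨m, hm⟩ := hM _ s2 _ s0 _ s3 _ s1
        refine hE.false_of_path hT h1 hm.1 hm.2.1 ?_ hm.2.2.1 hm.2.2.2
          (hT.of_not hne.symm hcon) b2 b1 b0
        refine hT.of_not ?_ fun h => hf (Or.inl ⟨s0, s3, h⟩)
        exact fun h => hLR' _ s0 (h ▸ s3)
  obtain ⟨k, rfl⟩ : ∃ k, N = k + 2 := ⟨N - 2, by omega⟩
  have hk : Even k := by simpa [Nat.even_add_one] using hNeven
  have h1 := (hforw k le_rfl).1 hk
  have h2 := hends (q k) ((hside k (by omega)).1 hk)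
    (fun h => by have := hinj k 0 (by omega) (by omega) (h.trans h0.symm); omega)
    (fun h => by have := hinj k (k + 2) (by omega) (by omega) (h.trans hN.symm); omega)
  rw [hN] at h1
  exact hT.asymm h1 h2.2

/-- No set of size at least `e` is complete to a disjoint set of size at least `e`. -/
def NoPurePair {V : Type*} (E : V → V → Prop) (e : ℕ) : Prop :=
  ∀ P Q : Finset V, Disjoint P Q → e ≤ P.card → e ≤ Q.card → ∃ p ∈ P, ∃ q ∈ Q, E q p

theorem NoPurePair.flip {V : Type*} {E : V → V → Prop} {e : ℕ} (h : NoPurePair E e) :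
    NoPurePair (flip E) e := by
  intro P Q hPQ hP hQ
  obtain ⟨q, hq, p, hp, hpq⟩ := h Q P hPQ.symm hQ hP
  exact ⟨p, hp, q, hq, hpq⟩

/-- Without large pure pairs, some connected set of the back arc graph between `A` and `K` covers
nearly all of `A` and `K`. -/
theorem NoPurePair.exists_giant_component {V : Type*} [Fintype V] {E : V → V → Prop}
    (hT : IsTournament E) {e : ℕ} (he : NoPurePair E e) {A K : Finset V} (hAK : Disjoint A K)
    (hA : 3 * e ≤ A.card) (hK : 2 * e ≤ K.card) :
    ∃ C : Finset V, (∀ x ∈ C, ∀ y ∈ C, (backGraph hT A K).Reachable x y) ∧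
      (A \ C).card < e ∧ (K \ C).card < e := by
  set G := backGraph hT A K with hG
  let closed (U : Finset V) : Prop := ∀ x ∈ U, ∀ y, G.Adj x y → y ∈ U
  have hlarge : ∀ U, closed U → e ≤ (A ∩ U).card → (A \ U).card < e ∧ (K \ U).card < e := by
    intro U hU hAU
    have hKU : (K \ U).card < e := by
      by_contra! h
      obtain ⟨p, hp, q, hq, hqp⟩ := he (A ∩ U) (K \ U)
        (hAK.mono Finset.inter_subset_left Finset.sdiff_subset) hAU h
      rw [Finset.mem_inter] at hp
      rw [Finset.mem_sdiff] at hq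
      exact hq.2 (hU p hp.2 q (Or.inl ⟨hp.1, hq.1, hqp⟩))
    refine ⟨?_, hKU⟩
    by_contra! h
    have hcard := Finset.card_sdiff_add_card_inter K U
    obtain ⟨p, hp, q, hq, hqp⟩ := he (A \ U) (K ∩ U)
      (hAK.mono Finset.sdiff_subset Finset.inter_subset_left) h (by omega)
    rw [Finset.mem_inter] at hq
    rw [Finset.mem_sdiff] at hp
    exact hp.2 (hU q hq.2 p (Or.inr ⟨hq.1, hp.1, hqp⟩))
  obtain ⟨U, hU, hmin⟩ := Finset.exists_min_image
    (Finset.univ.filter fun U : Finset V => closed U ∧ e ≤ (A ∩ U).card) Finset.card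
    ⟨Finset.univ, by
      simp only [Finset.mem_filter, Finset.mem_univ, true_and, Finset.inter_univ]
      exact ⟨fun _ _ _ _ => Finset.mem_univ _, by omega⟩⟩
  simp only [Finset.mem_filter, Finset.mem_univ, true_and] at hU hmin
  obtain ⟨hclosed, hcard⟩ := hU
  have hUlarge := hlarge U hclosed hcard
  refine ⟨U, fun x hx y hy => ?_, hUlarge⟩
  by_contra hxy
  set W := U.filter fun z => G.Reachable x z with hW
  have hxW : x ∈ W := Finset.mem_filter.2 ⟨hx, SimpleGraph.Reachable.refl x⟩
  have hyW : y ∉ W := fun h => hxy (Finset.mem_filter.1 h).2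
  have hWU : W ⊆ U := Finset.filter_subset _ _
  have hWclosed : closed W := by
    intro z hz w hzw
    rw [hW, Finset.mem_filter] at hz ⊢
    exact ⟨hclosed z hz.1 w hzw, hz.2.trans hzw.reachable⟩
  have hUWclosed : closed (U \ W) := by
    intro z hz w hzw
    rw [Finset.mem_sdiff] at hz ⊢
    exact ⟨hclosed z hz.1 w hzw, fun h => hz.2 (hWclosed w h z hzw.symm)⟩
  have h1 : (A ∩ W).card < e := by
    by_contra! h
    have := hmin W ⟨hWclosed, h⟩
    have := Finset.card_lt_card (Finset.ssubset_iff_subset_ne.2 ⟨hWU, fun h => hyW (h ▸ hy)⟩)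
    omega
  have h2 : (A ∩ (U \ W)).card < e := by
    by_contra! h
    have := hmin (U \ W) ⟨hUWclosed, h⟩
    have := Finset.card_lt_card (Finset.ssubset_iff_subset_ne.2
      ⟨(Finset.sdiff_subset : U \ W ⊆ U), fun h => (Finset.mem_sdiff.1 (h ▸ hx)).2 hxW⟩)
    omega
  have h3 : (A ∩ U).card ≤ (A ∩ W).card + (A ∩ (U \ W)).card := by
    rw [← Finset.card_union_of_disjoint]
    · refine Finset.card_le_card fun z hz => ?_
      simp only [Finset.mem_union, Finset.mem_inter, Finset.mem_sdiff] at hz ⊢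
      tauto
    · refine Finset.disjoint_left.2 fun z hz hz' => ?_
      simp only [Finset.mem_inter, Finset.mem_sdiff] at hz hz'
      tauto
  have := Finset.card_sdiff_add_card_inter A U
  omega

theorem Finset.exists_minimal_subset {V : Type*} {P : Finset V → Prop} {S : Finset V} (hS : P S) :
    ∃ Y ⊆ S, P Y ∧ ∀ z ∈ Y, ¬ P (Y.erase z) := by
  obtain ⟨Y, hY, hmin⟩ := Finset.exists_min_image (S.powerset.filter P) Finset.card
    ⟨S, by simp [hS]⟩
  simp only [Finset.mem_filter, Finset.mem_powerset] at hY hmin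
  refine ⟨Y, hY.1, hY.2, fun z hz h => ?_⟩
  have := hmin _ ⟨(Finset.erase_subset _ _).trans hY.1, h⟩
  have := Finset.card_erase_lt_of_mem hz
  omega

theorem Finset.card_filter_exists_le {V : Type*} (r : V → V → Prop) (A Y : Finset V) (z : V) :
    (A.filter fun a => ∃ y ∈ Y, r y a).card ≤
      (A.filter fun a => ∃ y ∈ Y.erase z, r y a).card + (A.filter fun a => r z a).card := by
  refine (Finset.card_le_card ?_).trans (Finset.card_union_le _ _)
  intro a ha
  simp only [Finset.mem_union, Finset.mem_filter, Finset.mem_erase] at ha ⊢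
  obtain ⟨ha, y, hy, hya⟩ := ha
  by_cases hyz : y = z
  · exact Or.inr ⟨ha, hyz ▸ hya⟩
  · exact Or.inl ⟨ha, y, ⟨hyz, hy⟩, hya⟩

theorem C5Free.false_of_dominating {V : Type*} [Fintype V] {E : V → V → Prop}
    (hT : IsTournament E) (hE : C5Free E) {e : ℕ} (he : NoPurePair E e) (he1 : 1 ≤ e)
    {A J K : Finset V} (hAJ : Disjoint A J) (hAK : Disjoint A K) (hJK : Disjoint J K)
    (hM : ∀ a ∈ A, ∀ a' ∈ A, ∀ b ∈ J ∪ K, ∀ b' ∈ J ∪ K,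
      ∃ m, E a m ∧ E a' m ∧ E m b ∧ E m b')
    (hdeg : ∀ y ∈ J, 24 * (A.filter fun a => E y a).card ≤ A.card)
    (hA : 24 * e ≤ A.card) (hK : 24 * e ≤ K.card)
    {Y : Finset V} (hYJ : Y ⊆ J)
    (hYA : A.card ≤ 3 * (A.filter fun a => ∃ y ∈ Y, E y a).card)
    (hYK : 2 * (K.filter fun k => ∃ y ∈ Y, E k y).card ≤ K.card) : False := by
  obtain ⟨Z, hZY, hZ, hZmin⟩ := Finset.exists_minimal_subset
    (P := fun Z => A.card ≤ 6 * (A.filter fun a => ∃ y ∈ Z, E y a).card) (S := Y)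
    (by omega)
  set N := A.filter fun a => ∃ y ∈ Z, E y a with hN
  set N' := A.filter fun a => ∃ y ∈ Y, E y a with hN'
  obtain ⟨z, hz⟩ : Z.Nonempty := by
    by_contra h
    rw [Finset.not_nonempty_iff_eq_empty] at h
    simp [hN, h] at hZ
    simp [hZ] at hA
    omega
  have hN6 : 24 * N.card ≤ 5 * A.card := by
    have h1 := Finset.card_filter_exists_le E A Z z
    have h2 := hdeg z (hYJ (hZY hz))
    have h3 := hZmin z hz
    rw [← hN] at h1
    omega
  set K₀ := K.filter fun k => ¬ ∃ y ∈ Y, E k y with hK₀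
  have hK₀card := Finset.card_filter_add_card_filter_not (s := K) (fun k => ∃ y ∈ Y, E k y)
  rw [← hK₀] at hK₀card
  have hNA : N ⊆ A := Finset.filter_subset _ _
  have hA₀card : (A \ N).card + N.card = A.card := Finset.card_sdiff_add_card_eq_card hNA
  have hK₀K : K₀ ⊆ K := Finset.filter_subset _ _
  obtain ⟨C, hC, hAC, hKC⟩ := he.exists_giant_component hT
    (hAK.mono (Finset.sdiff_subset : A \ N ⊆ A) hK₀K) (by omega) (by omega)
  obtain ⟨u, hu, huC⟩ : ∃ u ∈ N' \ N, u ∈ C := by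
    by_contra! h
    have h1 : N' \ N ⊆ (A \ N) \ C := by
      intro u hu
      have := h u hu
      simp only [hN', Finset.mem_sdiff, Finset.mem_filter] at hu ⊢
      tauto
    have := Finset.card_le_card h1
    have := Finset.le_card_sdiff N N'
    omega
  simp only [hN', Finset.mem_sdiff, Finset.mem_filter] at hu
  obtain ⟨⟨huA, y, hy, hyu⟩, huN⟩ := hu
  set L := N.filter fun l => ∃ k ∈ K₀ ∩ C, E k l with hL
  have hNL : (N \ L).card < e := by
    by_contra! h
    have := Finset.card_sdiff_add_card_inter K₀ C
    obtain ⟨p, hp, q, hq, hqp⟩ := he (N \ L) (K₀ ∩ C)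
      (hAK.mono (Finset.sdiff_subset.trans hNA) (Finset.inter_subset_left.trans hK₀K)) h
      (by omega)
    rw [Finset.mem_sdiff] at hp
    exact hp.2 (Finset.mem_filter.2 ⟨hp.1, q, hq, hqp⟩)
  have hLcard : (N \ L).card + L.card = N.card :=
    Finset.card_sdiff_add_card_eq_card (Finset.filter_subset _ _)
  obtain ⟨l, hl, hyl⟩ : ∃ l ∈ L, ¬ E y l := by
    by_contra! h
    have h1 : L ⊆ A.filter fun a => E y a := fun l hl =>
      Finset.mem_filter.2 ⟨hNA (Finset.mem_filter.1 hl).1, h l hl⟩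
    have := Finset.card_le_card h1
    have := hdeg y (hYJ hy)
    omega
  obtain ⟨hlN, k, hk, hkl⟩ := Finset.mem_filter.1 hl
  obtain ⟨hkK, hkC⟩ := Finset.mem_inter.1 hk
  obtain ⟨hlA, b, hb, hbl⟩ := Finset.mem_filter.1 hlN
  have hbJ := hYJ (hZY hb)
  have hyJ := hYJ hy
  have hbnot : ∀ x ∈ A \ N, ¬ E b x := fun x hx hbx => by
    rw [Finset.mem_sdiff] at hx
    exact hx.2 (Finset.mem_filter.2 ⟨hx.1, b, hb, hbx⟩)
  have hL' : insert l (A \ N) ⊆ A := Finset.insert_subset hlA Finset.sdiff_subset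
  have hR' : insert b (insert y K₀) ⊆ J ∪ K := by
    refine Finset.insert_subset (Finset.mem_union_left _ hbJ) (Finset.insert_subset
      (Finset.mem_union_left _ hyJ) (hK₀K.trans Finset.subset_union_right))
  have hto : ∀ w ∈ Y, ∀ r ∈ K₀, E w r := by
    intro w hw r hr
    refine hT.of_not (fun h => Finset.disjoint_left.1 hJK (hYJ hw) (h ▸ hK₀K hr)) fun h => ?_
    exact (Finset.mem_filter.1 hr).2 ⟨w, hw, h⟩
  have huA' : u ∈ A \ N := Finset.mem_sdiff.2 ⟨huA, fun h => huN (by simpa [hN] using h)⟩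
  refine hE.false_of_reachable hT (L := insert l (A \ N)) (R := insert b (insert y K₀))
    ((Finset.disjoint_union_right.2 ⟨hAJ, hAK⟩).mono hL' hR')
    (fun a ha a' ha' b hb b' hb' => hM a (hL' ha) a' (hL' ha') b (hR' hb) b' (hR' hb'))
    (b := b) (b' := y) (by simp) (by simp) ?_ ?_ ?_ ?_
  · rintro rfl
    exact hyl hbl
  · have h1 : (backGraph hT (insert l (A \ N)) (insert b (insert y K₀))).Adj b l :=
      Or.inr ⟨by simp, by simp, hbl⟩
    have h2 : (backGraph hT (insert l (A \ N)) (insert b (insert y K₀))).Adj l k :=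
      Or.inl ⟨by simp, by simp [hkK], hkl⟩
    have h3 : (backGraph hT (insert l (A \ N)) (insert b (insert y K₀))).Adj u y :=
      Or.inl ⟨Finset.mem_insert_of_mem huA', by simp, hyu⟩
    refine h1.reachable.trans (h2.reachable.trans (((hC k hkC u huC).mono ?_).trans h3.reachable))
    exact backGraph_mono hT (Finset.subset_insert _ _)
      ((Finset.subset_insert _ _).trans (Finset.subset_insert _ _))
  · intro x hx hbx
    rcases Finset.mem_insert.1 hx with rfl | hx
    · exact hyl
    · exact (hbnot x hx hbx).elim
  · intro r hr hrb hry
    simp only [Finset.mem_insert, hrb, hry, false_or] at hr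
    exact ⟨hto b (hZY hb) r hr, hto y hy r hr⟩

/-- Five disjoint sets such that every vertex is joined to each later set mostly by arcs towards
that set, and to each earlier set mostly by arcs from that set. -/
structure BlockChain {V : Type*} (E : V → V → Prop) (B : Fin 5 → Finset V) : Prop where
  disjoint : ∀ i j, i ≠ j → Disjoint (B i) (B j)
  in_le : ∀ i j, i < j → ∀ v ∈ B i, 24 * ((B j).filter fun x => E x v).card ≤ (B j).card
  out_le : ∀ i j, i < j → ∀ v ∈ B j, 24 * ((B i).filter fun x => E v x).card ≤ (B i).card

namespace BlockChain

variable {V : Type*} {E : V → V → Prop} {B : Fin 5 → Finset V}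

theorem flip (hB : BlockChain E B) : BlockChain (flip E) (B ∘ Fin.rev) where
  disjoint _ _ hij := hB.disjoint _ _ fun h => hij (Fin.rev_injective h)
  in_le _ _ hij := hB.out_le _ _ (Fin.rev_lt_rev.2 hij)
  out_le _ _ hij := hB.in_le _ _ (Fin.rev_lt_rev.2 hij)

theorem exists_middle (hT : IsTournament E) (hB : BlockChain E B) (h1 : (B 1).Nonempty) :
    ∀ a ∈ B 0, ∀ a' ∈ B 0, ∀ b ∈ B 2 ∪ B 4, ∀ b' ∈ B 2 ∪ B 4,
      ∃ m, E a m ∧ E a' m ∧ E m b ∧ E m b' := by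
  intro a ha a' ha' b hb b' hb'
  have hleft : ∀ a ∈ B 0, 24 * ((B 1).filter fun x => E x a).card ≤ (B 1).card :=
    hB.in_le 0 1 (by decide)
  have hright : ∀ b ∈ B 2 ∪ B 4, 24 * ((B 1).filter fun x => E b x).card ≤ (B 1).card := by
    intro b hb
    rcases Finset.mem_union.1 hb with hb | hb
    · exact hB.out_le 1 2 (by decide) b hb
    · exact hB.out_le 1 4 (by decide) b hb
  have hne : ∀ m ∈ B 1, (∀ a ∈ B 0, a ≠ m) ∧ ∀ b ∈ B 2 ∪ B 4, m ≠ b := by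
    intro m hm
    refine ⟨fun a ha h => Finset.disjoint_left.1 (hB.disjoint 0 1 (by decide)) ha (h ▸ hm),
      fun b hb h => ?_⟩
    rcases Finset.mem_union.1 hb with hb | hb
    · exact Finset.disjoint_left.1 (hB.disjoint 1 2 (by decide)) hm (h ▸ hb)
    · exact Finset.disjoint_left.1 (hB.disjoint 1 4 (by decide)) hm (h ▸ hb)
  have h4 := hleft a ha
  have h5 := hleft a' ha'
  have h6 := hright b hb
  have h7 := hright b' hb'
  have hpos := h1.card_pos
  obtain ⟨m, hm, hm'⟩ : ∃ m ∈ B 1, m ∉ (((B 1).filter fun x => E x a) ∪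
      (B 1).filter fun x => E x a') ∪ (((B 1).filter fun x => E b x) ∪
      (B 1).filter fun x => E b' x) := by
    by_contra! h
    have h8 := Finset.card_le_card (show B 1 ⊆ _ from h)
    have h9 := h8.trans ((Finset.card_union_le _ _).trans
      (add_le_add (Finset.card_union_le _ _) (Finset.card_union_le _ _)))
    omega
  simp only [Finset.mem_union, Finset.mem_filter, hm, true_and, not_or] at hm'
  obtain ⟨hl, hr⟩ := hne m hm
  exact ⟨m, hT.of_not (hl a ha) hm'.1.1, hT.of_not (hl a' ha') hm'.1.2,
    hT.of_not (hr b hb) hm'.2.1, hT.of_not (hr b' hb') hm'.2.2⟩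

theorem false_of_dominating [Fintype V] (hT : IsTournament E) (hE : C5Free E)
    (hB : BlockChain E B) {e : ℕ} (he : NoPurePair E e) (he1 : 1 ≤ e)
    (hcard : ∀ i, 24 * e ≤ (B i).card) {Y : Finset V} (hY : Y ⊆ B 2)
    (hYA : (B 0).card ≤ 3 * ((B 0).filter fun a => ∃ y ∈ Y, E y a).card)
    (hYK : 2 * ((B 4).filter fun k => ∃ y ∈ Y, E k y).card ≤ (B 4).card) : False := by
  have h1 : (B 1).Nonempty := by
    rw [← Finset.card_pos]
    have := hcard 1
    omega
  exact hE.false_of_dominating hT he he1 (hB.disjoint 0 2 (by decide))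
    (hB.disjoint 0 4 (by decide)) (hB.disjoint 2 4 (by decide)) (hB.exists_middle hT h1)
    (hB.out_le 0 2 (by decide)) (hcard 0) (hcard 4) hY hYA hYK

theorem false_of_noPurePair [Fintype V] (hT : IsTournament E) (hE : C5Free E)
    (hB : BlockChain E B) {e : ℕ} (he : NoPurePair E e) (he1 : 1 ≤ e)
    (hcard : ∀ i, 24 * e ≤ (B i).card) : False := by
  have hc0 := hcard 0
  have hc2 := hcard 2
  have hc4 := hcard 4
  obtain ⟨Y, hYJ, hY, hmin⟩ := Finset.exists_minimal_subset (S := B 2)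
    (P := fun Y => (B 0).card ≤ 3 * ((B 0).filter fun a => ∃ y ∈ Y, E y a).card ∨
      (B 4).card ≤ 3 * ((B 4).filter fun k => ∃ y ∈ Y, E k y).card) <| by
    left
    have hsum := Finset.card_filter_add_card_filter_not (s := B 0) (fun a => ∃ y ∈ B 2, E y a)
    suffices ((B 0).filter fun a => ¬ ∃ y ∈ B 2, E y a).card < e by omega
    by_contra! h
    obtain ⟨p, hp, q, hq, hqp⟩ := he _ (B 2)
      ((hB.disjoint 0 2 (by decide)).mono_left (Finset.filter_subset _ _)) h (by omega)
    exact (Finset.mem_filter.1 hp).2 q hq hqp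
  obtain ⟨z, hz⟩ : Y.Nonempty := by
    by_contra h
    rw [Finset.not_nonempty_iff_eq_empty] at h
    simp only [h, Finset.notMem_empty, false_and, exists_false, Finset.filter_false,
      Finset.card_empty] at hY
    omega
  have hz' := hmin z hz
  have h0 := Finset.card_filter_exists_le E (B 0) Y z
  have h4 := Finset.card_filter_exists_le (fun y k => E k y) (B 4) Y z
  have d0 := hB.out_le 0 2 (by decide) z (hYJ hz)
  have d4 := hB.in_le 2 4 (by decide) z (hYJ hz)
  rcases hY with hY | hY
  · exact hB.false_of_dominating hT hE he he1 hcard hYJ hY (by omega)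
  · refine hB.flip.false_of_dominating hT.flip hE.flip he.flip he1 (fun i => hcard _) hYJ hY ?_
    change 2 * ((B 0).filter fun a => ∃ y ∈ Y, E y a).card ≤ (B 0).card
    omega

end BlockChain

/-- At most a proportion `δ` of the arcs between `A` and `B` go from `B` to `A`. -/
def SparseBack {V : Type*} (E : V → V → Prop) (δ : ℝ) (A B : Finset V) : Prop :=
  (((A ×ˢ B).filter fun p => E p.2 p.1).card : ℝ) ≤ δ * A.card * B.card

theorem Finset.card_filter_product_eq_sum {V : Type*} (r : V → V → Prop) (A B : Finset V) :
    ((A ×ˢ B).filter fun p => r p.1 p.2).card = ∑ a ∈ A, (B.filter fun b => r a b).card := by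
  simp only [Finset.card_filter, Finset.sum_product]

theorem Finset.card_filter_product_eq_sum_right {V : Type*} (r : V → V → Prop) (A B : Finset V) :
    ((A ×ˢ B).filter fun p => r p.1 p.2).card = ∑ b ∈ B, (A.filter fun a => r a b).card := by
  simp only [Finset.card_filter, Finset.sum_product_right]

theorem sparseBack_of_in_le {V : Type*} {E : V → V → Prop} {δ : ℝ} {A B : Finset V}
    (h : ∀ a ∈ A, ((B.filter fun b => E b a).card : ℝ) ≤ δ * B.card) : SparseBack E δ A B := by
  unfold SparseBack
  rw [Finset.card_filter_product_eq_sum fun a b => E b a]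
  push_cast
  refine (Finset.sum_le_card_nsmul _ _ _ h).trans (le_of_eq ?_)
  rw [nsmul_eq_mul]
  ring

theorem sparseBack_of_out_le {V : Type*} {E : V → V → Prop} {δ : ℝ} {A B : Finset V}
    (h : ∀ b ∈ B, ((A.filter fun a => E b a).card : ℝ) ≤ δ * A.card) : SparseBack E δ A B := by
  unfold SparseBack
  rw [Finset.card_filter_product_eq_sum_right fun a b => E b a]
  push_cast
  refine (Finset.sum_le_card_nsmul _ _ _ h).trans (le_of_eq ?_)
  rw [nsmul_eq_mul]
  ring

theorem SparseBack.mono {V : Type*} {E : V → V → Prop} {δ c : ℝ} {A A' B : Finset V} (hδ : 0 ≤ δ)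
    (h : SparseBack E (δ * c) A B) (hA : A' ⊆ A) (hc : c * A.card ≤ A'.card) :
    SparseBack E δ A' B := by
  unfold SparseBack at *
  have h1 : ((A' ×ˢ B).filter fun p => E p.2 p.1).card ≤
      ((A ×ˢ B).filter fun p => E p.2 p.1).card :=
    Finset.card_le_card (Finset.filter_subset_filter _ (Finset.product_subset_product_left hA))
  calc (((A' ×ˢ B).filter fun p => E p.2 p.1).card : ℝ)
      ≤ ((A ×ˢ B).filter fun p => E p.2 p.1).card := by exact_mod_cast h1
    _ ≤ δ * c * A.card * B.card := h
    _ = δ * (c * A.card) * B.card := by ring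
    _ ≤ δ * A'.card * B.card := by gcongr

/-- Few vertices of `A` receive many arcs from `B`. -/
theorem SparseBack.card_filter_in_le {V : Type*} {E : V → V → Prop} {δ t : ℝ} {A B : Finset V}
    (ht : 0 < t) (h : SparseBack E (δ * t) A B) (hB : B.Nonempty) :
    ((A.filter fun a => t * B.card < (B.filter fun b => E b a).card).card : ℝ) ≤ δ * A.card := by
  unfold SparseBack at h
  rw [Finset.card_filter_product_eq_sum fun a b => E b a] at h
  push_cast at h
  set F := A.filter fun a => t * B.card < ((B.filter fun b => E b a).card : ℝ) with hF
  have h1 : F.card • (t * B.card : ℝ) ≤ ∑ a ∈ F, ((B.filter fun b => E b a).card : ℝ) :=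
    Finset.card_nsmul_le_sum _ _ _ fun a ha => (Finset.mem_filter.1 ha).2.le
  have h2 : ∑ a ∈ F, ((B.filter fun b => E b a).card : ℝ) ≤
      ∑ a ∈ A, ((B.filter fun b => E b a).card : ℝ) :=
    Finset.sum_le_sum_of_subset_of_nonneg (Finset.filter_subset _ _) fun _ _ _ => by positivity
  have hpos : 0 < t * B.card := mul_pos ht (by exact_mod_cast hB.card_pos)
  rw [nsmul_eq_mul] at h1
  refine le_of_mul_le_mul_right ?_ hpos
  linarith

/-- Few vertices of `B` send many arcs to `A`. -/
theorem SparseBack.card_filter_out_le {V : Type*} {E : V → V → Prop} {δ t : ℝ} {A B : Finset V}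
    (ht : 0 < t) (h : SparseBack E (δ * t) A B) (hA : A.Nonempty) :
    ((B.filter fun b => t * A.card < (A.filter fun a => E b a).card).card : ℝ) ≤ δ * B.card := by
  unfold SparseBack at h
  rw [Finset.card_filter_product_eq_sum_right fun a b => E b a] at h
  push_cast at h
  set F := B.filter fun b => t * A.card < ((A.filter fun a => E b a).card : ℝ) with hF
  have h1 : F.card • (t * A.card : ℝ) ≤ ∑ b ∈ F, ((A.filter fun a => E b a).card : ℝ) :=
    Finset.card_nsmul_le_sum _ _ _ fun b hb => (Finset.mem_filter.1 hb).2.le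
  have h2 : ∑ b ∈ F, ((A.filter fun a => E b a).card : ℝ) ≤
      ∑ b ∈ B, ((A.filter fun a => E b a).card : ℝ) :=
    Finset.sum_le_sum_of_subset_of_nonneg (Finset.filter_subset _ _) fun _ _ _ => by positivity
  have hpos : 0 < t * A.card := mul_pos ht (by exact_mod_cast hA.card_pos)
  rw [nsmul_eq_mul] at h1
  refine le_of_mul_le_mul_right ?_ hpos
  linarith

theorem Finset.exists_disjoint_family {V : Type*} {S : Finset V} {s : ℕ} (hs : 5 * s ≤ S.card) :
    ∃ P : Fin 5 → Finset V, (∀ i, P i ⊆ S) ∧ (∀ i j, i ≠ j → Disjoint (P i) (P j)) ∧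
      ∀ i, (P i).card = s := by
  obtain ⟨g⟩ : Nonempty (Fin 5 × Fin s ↪ S) :=
    Function.Embedding.nonempty_of_card_le (by simpa using hs)
  refine ⟨fun i => Finset.univ.image fun x => (g (i, x) : V), ?_, ?_, ?_⟩
  · intro i v hv
    obtain ⟨x, -, rfl⟩ := Finset.mem_image.1 hv
    exact (g (i, x)).2
  · intro i j hij
    refine Finset.disjoint_left.2 fun v hv hv' => ?_
    obtain ⟨x, -, rfl⟩ := Finset.mem_image.1 hv
    obtain ⟨y, -, hxy⟩ := Finset.mem_image.1 hv'
    have := g.injective (Subtype.ext hxy)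
    simp only [Prod.mk.injEq] at this
    exact hij this.1.symm
  · intro i
    rw [Finset.card_image_of_injective, Finset.card_univ, Fintype.card_fin]
    intro x y hxy
    have := g.injective (Subtype.ext hxy)
    simpa using this

/-- A vertex of `P k` with many neighbours of the prescribed kind in each of the given sets exists,
unless two of the sets contain a sparse pair. -/
theorem exists_vertex_of_no_sparseBack {V : Type*} {E : V → V → Prop}
    {δ m : ℝ} (hm : 0 ≤ m) {S : Finset V}
    (hS : ∀ A ⊆ S, ∀ B ⊆ S, Disjoint A B → m ≤ A.card → m ≤ B.card → ¬ SparseBack E δ A B)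
    {P : Fin 5 → Finset V} (hPS : ∀ i, P i ⊆ S) (hP : ∀ i j, i ≠ j → Disjoint (P i) (P j))
    (k : Fin 5) (hk : 5 * m < (P k).card) (hcard : ∀ j, k < j → m ≤ (P j).card) :
    ∃ v ∈ P k, ∀ j, k < j → δ * (P j).card ≤
      ((P j).filter fun y => (C5 k j → E v y) ∧ (C5 j k → E y v)).card := by
  by_contra! hcon
  set bad : Fin 5 → Finset V := fun j => (P k).filter fun v => k < j ∧
    (((P j).filter fun y => (C5 k j → E v y) ∧ (C5 j k → E y v)).card : ℝ) < δ * (P j).card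
    with hbad
  have hcover : P k ⊆ Finset.univ.biUnion bad := by
    intro v hv
    obtain ⟨j, hj, hlt⟩ := hcon v hv
    exact Finset.mem_biUnion.2 ⟨j, Finset.mem_univ j, Finset.mem_filter.2 ⟨hv, hj, hlt⟩⟩
  obtain ⟨j, hj⟩ : ∃ j, m < (bad j).card := by
    by_contra! h
    have h1 : ((P k).card : ℝ) ≤ ∑ j, ((bad j).card : ℝ) := by
      exact_mod_cast (Finset.card_le_card hcover).trans Finset.card_biUnion_le
    have h2 : ∑ j, ((bad j).card : ℝ) ≤ ∑ _j : Fin 5, m := Finset.sum_le_sum fun j _ => h j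
    simp only [Finset.sum_const, Finset.card_univ, Fintype.card_fin, nsmul_eq_mul] at h2
    push_cast at h2
    linarith
  have hkj : k < j := by
    by_contra h
    have h0 : bad j = ∅ := by simp [hbad, h]
    rw [h0, Finset.card_empty, Nat.cast_zero] at hj
    linarith
  have hbadk : bad j ⊆ P k := Finset.filter_subset _ _
  have hdisj := (hP k j hkj.ne).mono_left hbadk
  have hlt : ∀ v ∈ bad j,
      (((P j).filter fun y => (C5 k j → E v y) ∧ (C5 j k → E y v)).card : ℝ) < δ * (P j).card :=
    fun v hv => (Finset.mem_filter.1 hv).2.2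
  rcases C5_or_C5 k j hkj.ne with h | h
  · simp only [h, C5_asymm _ _ h, forall_true_left, false_imp_iff, and_true] at hlt
    exact hS _ (hPS j) _ (hbadk.trans (hPS k)) hdisj.symm (hcard j hkj) hj.le
      (sparseBack_of_out_le fun v hv => (hlt v hv).le)
  · simp only [h, C5_asymm _ _ h, forall_true_left, false_imp_iff, true_and] at hlt
    exact hS _ (hbadk.trans (hPS k)) _ (hPS j) hdisj hj.le (hcard j hkj)
      (sparseBack_of_in_le fun v hv => (hlt v hv).le)

theorem C5Free.exists_sparseBack {V : Type*} {E : V → V → Prop} (hT : IsTournament E)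
    (hE : C5Free E) {δ m : ℝ} (hδ : 0 < δ) (hδ1 : δ ≤ 1) (hm : 0 ≤ m) {s : ℕ}
    (hms : 5 * m < δ ^ 4 * s) {S : Finset V} (hs : 5 * s ≤ S.card) :
    ∃ A ⊆ S, ∃ B ⊆ S, Disjoint A B ∧ m ≤ A.card ∧ m ≤ B.card ∧ SparseBack E δ A B := by
  by_contra hcon
  have hS : ∀ A ⊆ S, ∀ B ⊆ S, Disjoint A B → m ≤ A.card → m ≤ B.card → ¬ SparseBack E δ A B :=
    fun A hA B hB hAB hmA hmB h => hcon ⟨A, hA, B, hB, hAB, hmA, hmB, h⟩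
  have key : ∀ k ≤ 5, ∃ P : Fin 5 → Finset V, (∀ i, P i ⊆ S) ∧
      (∀ i j, i ≠ j → Disjoint (P i) (P j)) ∧ (∀ i : Fin 5, i.val < k → (P i).Nonempty) ∧
      (∀ i : Fin 5, k ≤ i.val → δ ^ k * s ≤ (P i).card) ∧
      ∀ i j : Fin 5, i.val < k → i ≠ j → ∀ x ∈ P i, ∀ y ∈ P j,
        (C5 i j → E x y) ∧ (C5 j i → E y x) := by
    intro k
    induction k with
    | zero =>
      intro _
      obtain ⟨P, hPS, hP, hcard⟩ := Finset.exists_disjoint_family hs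
      exact ⟨P, hPS, hP, by simp, by simp [hcard], by simp⟩
    | succ k ih =>
      intro hk
      obtain ⟨P, hPS, hP, hne, hcard, hadj⟩ := ih (by omega)
      obtain ⟨κ, rfl⟩ : ∃ κ : Fin 5, κ.val = k := ⟨⟨k, by omega⟩, rfl⟩
      have hpow : δ ^ 4 * s ≤ δ ^ κ.val * s :=
        mul_le_mul_of_nonneg_right (pow_le_pow_of_le_one hδ.le hδ1 (by omega)) (by positivity)
      obtain ⟨v, hv, hvP⟩ := exists_vertex_of_no_sparseBack hm hS hPS hP κ
        (by linarith [hcard κ le_rfl])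
        (fun j hj => by linarith [hcard j (Fin.le_def.1 hj.le)])
      let Q : Fin 5 → Finset V := fun j => if j = κ then {v} else if κ < j then
        (P j).filter (fun y => (C5 κ j → E v y) ∧ (C5 j κ → E y v)) else P j
      have hQP : ∀ j, Q j ⊆ P j := by
        intro j
        simp only [Q]
        split_ifs with h1 h2
        · simpa [h1] using hv
        · exact Finset.filter_subset _ _
        · exact subset_rfl
      have hQκ : Q κ = {v} := by simp [Q]
      refine ⟨Q, fun i => (hQP i).trans (hPS i),
        fun i j hij => (hP i j hij).mono (hQP i) (hQP j), ?_, ?_, ?_⟩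
      · intro i hi
        rcases eq_or_ne i κ with rfl | h1
        · simp [hQκ]
        · have h2 : i < κ := lt_of_le_of_ne (Fin.le_def.2 (by omega)) h1
          simpa [Q, h1, h2.not_gt] using hne i (Fin.lt_def.1 h2)
      · intro i hi
        have h2 : κ < i := Fin.lt_def.2 (by omega)
        have h3 : Q i = (P i).filter (fun y => (C5 κ i → E v y) ∧ (C5 i κ → E y v)) := by
          simp [Q, h2.ne', h2]
        rw [h3]
        refine le_trans ?_ (hvP i h2)
        rw [pow_succ', mul_assoc]
        exact mul_le_mul_of_nonneg_left (hcard i (Fin.le_def.1 h2.le)) hδ.le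
      · intro i j hi hij x hx y hy
        rcases eq_or_ne i κ with rfl | h1
        · rw [hQκ, Finset.mem_singleton] at hx
          subst hx
          rcases lt_or_gt_of_ne hij with h2 | h2
          · simp only [Q, hij.symm, h2, if_true, if_false, Finset.mem_filter] at hy
            exact hy.2
          · exact (hadj j i (Fin.lt_def.1 h2) hij.symm y (hQP j hy) x hv).symm
        · have h2 : i < κ := lt_of_le_of_ne (Fin.le_def.2 (by omega)) h1
          exact hadj i j (Fin.lt_def.1 h2) hij x (hQP i hx) y (hQP j hy)
  obtain ⟨P, -, -, hne, -, hadj⟩ := key 5 le_rfl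
  choose f hf using fun i => hne i i.isLt
  have hfE : ∀ i j, C5 i j → E (f i) (f j) := fun i j hij =>
    (hadj i j i.isLt (by rintro rfl; exact C5_asymm _ _ hij hij) _ (hf i) _ (hf j)).1 hij
  exact hE ⟨f, hT.injective_of_C5 hfE, hfE⟩

theorem exists_sparseBack_const {δ : ℝ} (hδ : 0 < δ) :
    ∃ c : ℝ, 0 < c ∧ c ≤ 1 ∧ ∀ (V : Type) (E : V → V → Prop), IsTournament E → C5Free E →
      ∀ S : Finset V, 1 ≤ c * S.card → ∃ A ⊆ S, ∃ B ⊆ S, Disjoint A B ∧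
        c * S.card ≤ A.card ∧ c * S.card ≤ B.card ∧ SparseBack E δ A B := by
  wlog hδ1 : δ ≤ 1 generalizing δ
  · obtain ⟨c, hc, hc1, h⟩ := this one_pos le_rfl
    refine ⟨c, hc, hc1, fun V E hT hE S hS => ?_⟩
    obtain ⟨A, hA, B, hB, hAB, hcA, hcB, hsp⟩ := h V E hT hE S hS
    refine ⟨A, hA, B, hB, hAB, hcA, hcB, le_trans hsp ?_⟩
    gcongr
    linarith
  have h4 : δ ^ 4 ≤ 1 := pow_le_one₀ hδ.le hδ1
  refine ⟨δ ^ 4 / 100, by positivity, by linarith, fun V E hT hE S hS => ?_⟩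
  have hcard : (100 : ℝ) ≤ S.card := by
    have : δ ^ 4 / 100 * S.card ≤ 1 / 100 * S.card := by gcongr
    linarith
  have hcard' : 100 ≤ S.card := by exact_mod_cast hcard
  have hs : (S.card : ℝ) ≤ 10 * (S.card / 5 : ℕ) := by
    exact_mod_cast (by omega : S.card ≤ 10 * (S.card / 5))
  refine hE.exists_sparseBack hT hδ hδ1 (by positivity) (s := S.card / 5) ?_ (by omega)
  have h5 : 0 < δ ^ 4 := by positivity
  nlinarith [mul_le_mul_of_nonneg_left hs h5.le]

theorem exists_sparseBack_sequence (k : ℕ) {δ : ℝ} (hδ : 0 < δ) :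
    ∃ c : ℝ, 0 < c ∧ c ≤ 1 ∧ ∀ (V : Type) (E : V → V → Prop), IsTournament E → C5Free E →
      ∀ S : Finset V, 1 ≤ c * S.card → ∃ B : ℕ → Finset V,
        (∀ i < k, B i ⊆ S ∧ c * S.card ≤ (B i).card) ∧
        ∀ i j, i < j → j < k → Disjoint (B i) (B j) ∧ SparseBack E δ (B i) (B j) := by
  induction k with
  | zero =>
    exact ⟨1, one_pos, le_rfl, fun V E _ _ S _ => ⟨fun _ => ∅, by simp, by simp⟩⟩
  | succ k ih =>
    obtain ⟨c, hc, hc1, hseq⟩ := ih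
    obtain ⟨c', hc', hc'1, hpair⟩ := exists_sparseBack_const (mul_pos hδ hc)
    refine ⟨c * c', by positivity, mul_le_one₀ hc1 hc'.le hc'1, fun V E hT hE S hS => ?_⟩
    have hle : c * c' * S.card ≤ c' * S.card := by
      have : c * c' ≤ c' := mul_le_of_le_one_left hc'.le hc1
      gcongr
    obtain ⟨A, hA, D, hD, hAD, hcA, hcD, hsp⟩ := hpair V E hT hE S (hS.trans hle)
    have hcA' : c * c' * S.card ≤ c * A.card := by
      rw [mul_assoc]
      gcongr
    obtain ⟨B, hB, hBB⟩ := hseq V E hT hE A (hS.trans hcA')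
    refine ⟨fun i => if i < k then B i else D, fun i hi => ?_, fun i j hij hj => ?_⟩
    · by_cases h : i < k
      · simp only [h, if_true]
        exact ⟨(hB i h).1.trans hA, hcA'.trans (hB i h).2⟩
      · simp only [h, if_false]
        exact ⟨hD, hle.trans hcD⟩
    · have hi : i < k := by omega
      by_cases h : j < k
      · simp only [hi, h, if_true]
        exact hBB i j hij h
      · simp only [hi, h, if_true, if_false]
        exact ⟨hAD.mono_left (hB i hi).1, hsp.mono hδ.le (hB i hi).1 (hB i hi).2⟩

theorem exists_blockChain :
    ∃ c : ℝ, 0 < c ∧ c ≤ 1 ∧ ∀ (V : Type) [Fintype V] (E : V → V → Prop), IsTournament E →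
      C5Free E → 1 ≤ c * Fintype.card V →
        ∃ B : Fin 5 → Finset V, BlockChain E B ∧ ∀ i, c * Fintype.card V ≤ 2 * (B i).card := by
  obtain ⟨c, hc, hc1, hseq⟩ := exists_sparseBack_sequence 5 (δ := 1 / 25 * (1 / 40)) (by norm_num)
  refine ⟨c, hc, hc1, fun V _ E hT hE hcard => ?_⟩
  obtain ⟨P, hP, hPP⟩ := hseq V E hT hE Finset.univ hcard
  rw [Finset.card_univ] at hP
  have hPne : ∀ i < 5, (P i).Nonempty := by
    intro i hi
    rw [← Finset.card_pos]
    have : (0 : ℝ) < (P i).card := by linarith [(hP i hi).2]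
    exact_mod_cast this
  let wrong (i j : Fin 5) (v x : V) : Prop := (i < j ∧ E x v) ∨ (j < i ∧ E v x)
  let bad (i j : Fin 5) : Finset V := (P i).filter fun v =>
    1 / 40 * ((P j).card : ℝ) < ((P j).filter fun x => wrong i j v x).card
  have hbad : ∀ i j : Fin 5, ((bad i j).card : ℝ) ≤ 1 / 25 * (P i).card := by
    intro i j
    rcases lt_trichotomy i j with h | rfl | h
    · have := (hPP i j h j.isLt).2.card_filter_in_le (by norm_num) (hPne j j.isLt)
      simpa [bad, wrong, h, h.not_gt] using this
    · have h0 : ¬ (40⁻¹ * ((P i).card : ℝ) < 0) := not_lt.2 (by positivity)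
      simp [bad, wrong, h0]
    · have := (hPP j i h i.isLt).2.card_filter_out_le (by norm_num) (hPne j j.isLt)
      simpa [bad, wrong, h, h.not_gt] using this
  let B (i : Fin 5) : Finset V := P i \ Finset.univ.biUnion (bad i)
  have hBP : ∀ i : Fin 5, B i ⊆ P i := fun i => Finset.sdiff_subset
  have hBcard : ∀ i : Fin 5, 4 / 5 * ((P i).card : ℝ) ≤ (B i).card := by
    intro i
    have h1 : ((P i).card : ℝ) ≤ (B i).card + (Finset.univ.biUnion (bad i)).card := by
      have := Finset.le_card_sdiff (Finset.univ.biUnion (bad i)) (P i)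
      exact_mod_cast (by omega : (P i).card ≤ (P i \ Finset.univ.biUnion (bad i)).card +
        (Finset.univ.biUnion (bad i)).card)
    have h2 : ((Finset.univ.biUnion (bad i)).card : ℝ) ≤ ∑ j, ((bad i j).card : ℝ) := by
      exact_mod_cast Finset.card_biUnion_le
    have h3 : ∑ j, ((bad i j).card : ℝ) ≤ ∑ _j : Fin 5, 1 / 25 * ((P i).card : ℝ) :=
      Finset.sum_le_sum fun j _ => hbad i j
    simp only [Finset.sum_const, Finset.card_univ, Fintype.card_fin, nsmul_eq_mul] at h3
    push_cast at h3
    linarith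
  have hwrong : ∀ i j : Fin 5, ∀ v ∈ B i,
      24 * ((B j).filter fun x => wrong i j v x).card ≤ (B j).card := by
    intro i j v hv
    rw [Finset.mem_sdiff] at hv
    have h1 : (((P j).filter fun x => wrong i j v x).card : ℝ) ≤ 1 / 40 * (P j).card := by
      by_contra! h
      exact hv.2 (Finset.mem_biUnion.2 ⟨j, Finset.mem_univ j, Finset.mem_filter.2 ⟨hv.1, h⟩⟩)
    have h2 : (((B j).filter fun x => wrong i j v x).card : ℝ) ≤
        ((P j).filter fun x => wrong i j v x).card := by
      exact_mod_cast Finset.card_le_card (Finset.filter_subset_filter _ (hBP j))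
    have h3 := hBcard j
    have h4 : (24 * ((B j).filter fun x => wrong i j v x).card : ℝ) ≤ (B j).card := by linarith
    exact_mod_cast h4
  refine ⟨B, ⟨fun i j hij => ?_, fun i j hij v hv => ?_, fun i j hij v hv => ?_⟩, fun i => ?_⟩
  · refine Disjoint.mono (hBP i) (hBP j) ?_
    rcases lt_or_gt_of_ne hij with h | h
    · exact (hPP i j h j.isLt).1
    · exact (hPP j i h i.isLt).1.symm
  · simpa [wrong, hij, hij.not_gt] using hwrong i j v hv
  · simpa [wrong, hij, hij.not_gt] using hwrong j i v hv
  · linarith [hBcard i, (hP i i.isLt).2]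

end

/-- The class of `C₅`-free tournaments has the strong Erdős–Hajnal property:
there is `ε > 0` such that every `C₅`-free tournament on `n ≥ 2` vertices has
disjoint vertex sets `A`, `B` of size at least `ε·n` with `A` complete to `B`. -/
theorem strong_EH_for_C5_free :
    ∃ ε : ℝ, 0 < ε ∧
      ∀ (V : Type) [Fintype V] (E : V → V → Prop),
        (∀ v : V, ¬ E v v) →
        (∀ u v : V, u ≠ v → (E u v ↔ ¬ E v u)) →
        2 ≤ Fintype.card V →
        (¬ ∃ f : Fin 5 → V, Function.Injective f ∧
            ∀ i j : Fin 5, C5 i j → E (f i) (f j)) →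
        ∃ A B : Finset V, Disjoint A B ∧
          ε * (Fintype.card V : ℝ) ≤ (A.card : ℝ) ∧
          ε * (Fintype.card V : ℝ) ≤ (B.card : ℝ) ∧
          ∀ a ∈ A, ∀ b ∈ B, E a b := by
  obtain ⟨c, hc, -, hchain⟩ := exists_blockChain
  refine ⟨c / 96, by positivity, fun V _ E hirr hiff hV hE => ?_⟩
  have hT : IsTournament E := ⟨hirr, hiff⟩
  rcases le_or_gt (c / 96 * (Fintype.card V : ℝ)) 1 with hsmall | hbig
  · obtain ⟨u, v, huv⟩ := Fintype.exists_pair_of_one_lt_card hV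
    by_cases h : E u v
    · exact ⟨{u}, {v}, by simpa using huv, by simpa using hsmall, by simpa using hsmall,
        by simpa using h⟩
    · exact ⟨{v}, {u}, by simpa using huv.symm, by simpa using hsmall, by simpa using hsmall,
        by simpa using hT.of_not huv.symm h⟩
  · by_contra! hcon
    set e := ⌈c / 96 * (Fintype.card V : ℝ)⌉₊ with he
    have he1 : 1 ≤ e := Nat.one_le_ceil_iff.2 (by linarith)
    have hele : (e : ℝ) ≤ c / 96 * Fintype.card V + 1 := (Nat.ceil_lt_add_one (by linarith)).le
    have hpure : NoPurePair E e := by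
      intro P Q hPQ hP hQ
      obtain ⟨p, hp, q, hq, hpq⟩ := hcon P Q hPQ (Nat.ceil_le.1 hP) (Nat.ceil_le.1 hQ)
      exact ⟨p, hp, q, hq,
        hT.of_not (fun h => Finset.disjoint_left.1 hPQ hp (h ▸ hq)) hpq⟩
    obtain ⟨B, hB, hcard⟩ := hchain V E hT hE (by linarith)
    refine hB.false_of_noPurePair hT hE hpure he1 fun i => ?_
    have : (24 * e : ℝ) ≤ (B i).card := by linarith [hcard i]
    exact_mod_cast this
end

section
/- Let D be an outsimplicial directed graph on n > 1 vertices. Then there exist two disjoint subsets A and B of V(D), both of size at least ⌊n/6⌋, such that either (i) there is no edge, in either direction, between any vertex of A and any vertex of B, or (ii) for every a ∈ A and b ∈ B there is a directed path in D from a to b. -/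
namespace Outsimplicial

variable {V : Type}

/-- In an outsimplicial digraph, two vertices reachable from a common vertex are comparable
for reachability. -/
theorem reachable_comparable {E : V → V → Prop}
    (hout : ∀ u v w : V, v ≠ w → E u v → E u w → E v w ∨ E w v) {u x y : V}
    (hx : Relation.ReflTransGen E u x) (hy : Relation.ReflTransGen E u y) :
    Relation.ReflTransGen E x y ∨ Relation.ReflTransGen E y x := by
  have edge : ∀ {u x : V}, Relation.ReflTransGen E u x → ∀ w, E u w →
      Relation.ReflTransGen E x w ∨ Relation.ReflTransGen E w x := by
    intro u x h
    induction h using Relation.ReflTransGen.head_induction_on with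
    | refl => exact fun w hw => Or.inl (.single hw)
    | head huv hvx ih =>
      rename_i a c
      intro w hw
      by_cases hcw : c = w
      · exact Or.inr (hcw ▸ hvx)
      · rcases hout a c w hcw huv hw with h | h
        · exact ih w h
        · exact Or.inr (.head h hvx)
  induction hy using Relation.ReflTransGen.head_induction_on with
  | refl => exact Or.inr hx
  | head huv hvy ih =>
    rcases edge hx _ huv with h | h
    · exact Or.inl (h.trans hvy)
    · exact ih h

variable [Fintype V]

open Classical in
/-- The vertices below `x` for the relation `R`. -/
noncomputable def down (R : V → V → Prop) (x : V) : Finset V := {y | R y x}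

theorem mem_down {R : V → V → Prop} {x y : V} : y ∈ down R x ↔ R y x := by
  simp [down]

theorem down_subset {R : V → V → Prop} (htrans : ∀ x y z, R x y → R y z → R x z) {x y : V}
    (h : R x y) : down R x ⊆ down R y :=
  fun _ hz => mem_down.2 (htrans _ _ _ (mem_down.1 hz) h)

/-- A lower set in a forest preorder, all of whose principal lower sets are small, contains two
large sets with no comparabilities between them. -/
theorem exists_incomparable_of_small_down {R : V → V → Prop} (hrefl : ∀ x, R x x)
    (htrans : ∀ x y z, R x y → R y z → R x z)
    (hchain : ∀ u x y, R u x → R u y → R x y ∨ R y x) {m : ℕ} (hm : 0 < m) (S : Finset V)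
    (hS : ∀ x ∈ S, ∀ y, R y x → y ∈ S) (hsmall : ∀ x ∈ S, (down R x).card < 2 * m)
    (hcard : 3 * m ≤ S.card) :
    ∃ A B : Finset V, Disjoint A B ∧ m ≤ A.card ∧ m ≤ B.card ∧
      ∀ a ∈ A, ∀ b ∈ B, ¬ R a b ∧ ¬ R b a := by
  classical
  let closed : Finset V → Prop := fun T => ∀ x ∈ T, ∀ y ∈ S, R x y ∨ R y x → y ∈ T
  obtain ⟨T, hT, hmin⟩ := Finset.exists_min_image
    (S.powerset.filter fun T => closed T ∧ m ≤ T.card) Finset.card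
    ⟨S, by
      simp only [Finset.mem_filter, Finset.mem_powerset]
      exact ⟨subset_rfl, fun _ _ _ hy _ => hy, by omega⟩⟩
  simp only [Finset.mem_filter, Finset.mem_powerset] at hT hmin
  obtain ⟨hTS, hTc, hTm⟩ := hT
  obtain ⟨y, hyT, hymax⟩ := Finset.exists_max_image T (fun x => (down R x).card)
    (Finset.card_pos.1 (by omega))
  have hytop : ∀ w ∈ T, R y w → R w y := fun w hw hyw => by
    rw [← mem_down (R := R), Finset.eq_of_subset_of_card_le (down_subset htrans hyw) (hymax w hw)]
    exact mem_down.2 (hrefl w)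
  have hdS : down R y ⊆ S := fun z hz => hS y (hTS hyT) z (mem_down.1 hz)
  have hdT : down R y ⊆ T := fun z hz => hTc y hyT z (hdS hz) (Or.inr (mem_down.1 hz))
  have hdc : closed (down R y) := by
    intro z hz w hw h
    have hwT : w ∈ T := hTc z (hdT hz) w hw h
    rw [mem_down] at hz ⊢
    rcases h with h | h
    · exact (hchain z w y h hz).elim id (hytop w hwT)
    · exact htrans _ _ _ h hz
  have hTlt : T.card < 2 * m := by
    have hd := hsmall y (hTS hyT)
    by_cases hdm : m ≤ (down R y).card
    · exact (hmin _ ⟨hdS, hdc, hdm⟩).trans_lt hd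
    · by_contra hlt
      have hsd := Finset.card_sdiff_add_card_eq_card hdT
      have hpos : 0 < (down R y).card := Finset.card_pos.2 ⟨y, mem_down.2 (hrefl y)⟩
      have := hmin (T \ down R y) ⟨Finset.sdiff_subset.trans hTS, fun z hz w hw h => by
        rw [Finset.mem_sdiff] at hz ⊢
        exact ⟨hTc z hz.1 w hw h, fun hwd => hz.2 (hdc w hwd z (hTS hz.1) h.symm)⟩, by omega⟩
      omega
  refine ⟨T, S \ T, Finset.disjoint_sdiff, hTm, ?_, fun a ha b hb => ?_⟩
  · have := Finset.card_sdiff_add_card_eq_card hTS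
    omega
  · rw [Finset.mem_sdiff] at hb
    exact ⟨fun h => hb.2 (hTc a ha b hb.1 (Or.inl h)), fun h => hb.2 (hTc a ha b hb.1 (Or.inr h))⟩

/-- A finite forest preorder contains two disjoint sets, each with at least a sixth of the
elements, that are either completely incomparable or such that one lies below the other. -/
theorem exists_incomparable_or_below {R : V → V → Prop} (hrefl : ∀ x, R x x)
    (htrans : ∀ x y z, R x y → R y z → R x z)
    (hchain : ∀ u x y, R u x → R u y → R x y ∨ R y x) {m : ℕ} (hm : 6 * m ≤ Fintype.card V) :
    ∃ A B : Finset V, Disjoint A B ∧ m ≤ A.card ∧ m ≤ B.card ∧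
      ((∀ a ∈ A, ∀ b ∈ B, ¬ R a b ∧ ¬ R b a) ∨ ∀ a ∈ A, ∀ b ∈ B, R a b) := by
  classical
  rcases Nat.eq_zero_or_pos m with rfl | hpos
  · exact ⟨∅, ∅, by simp⟩
  have of_small : ∀ S : Finset V, (∀ x ∈ S, ∀ y, R y x → y ∈ S) →
      (∀ x ∈ S, (down R x).card < 2 * m) → 3 * m ≤ S.card →
      ∃ A B : Finset V, Disjoint A B ∧ m ≤ A.card ∧ m ≤ B.card ∧
        ((∀ a ∈ A, ∀ b ∈ B, ¬ R a b ∧ ¬ R b a) ∨ ∀ a ∈ A, ∀ b ∈ B, R a b) := by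
    intro S h₁ h₂ h₃
    obtain ⟨A, B, h, hA, hB, hAB⟩ :=
      exists_incomparable_of_small_down hrefl htrans hchain hpos S h₁ h₂ h₃
    exact ⟨A, B, h, hA, hB, Or.inl hAB⟩
  by_cases hbig : ∃ x, 2 * m ≤ (down R x).card
  swap
  · push Not at hbig
    exact of_small Finset.univ (by simp) (fun x _ => hbig x) (by rw [Finset.card_univ]; omega)
  obtain ⟨x, hx, hxmin⟩ := Finset.exists_min_image
    (Finset.univ.filter fun x => 2 * m ≤ (down R x).card) (fun x => (down R x).card)
    (by obtain ⟨x, hx⟩ := hbig; exact ⟨x, by simpa using hx⟩)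
  simp only [Finset.mem_filter, Finset.mem_univ, true_and] at hx hxmin
  let C : Finset V := {y | R y x ∧ R x y}
  let L : Finset V := {y | R y x ∧ ¬ R x y}
  let P : Finset V := {y | ¬ R y x ∧ R x y}
  let I : Finset V := {y | ¬ R y x ∧ ¬ R x y}
  have hdown : (down R x).card = C.card + L.card := by
    rw [← Finset.card_filter_add_card_filter_not (s := down R x) (R x)]
    simp only [down, Finset.filter_filter, C, L]
  have hrest : Fintype.card V = (down R x).card + (P.card + I.card) := by
    rw [← Finset.card_univ, ← Finset.card_filter_add_card_filter_not (s := Finset.univ) (R · x),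
      ← Finset.card_filter_add_card_filter_not (s := Finset.univ.filter (¬ R · x)) (R x)]
    simp only [down, Finset.filter_filter, P, I]
  by_cases hI : m ≤ I.card
  · refine ⟨down R x, I, ?_, by omega, hI, Or.inl fun a ha b hb => ?_⟩
    · rw [Finset.disjoint_left]
      intro a ha hb
      simp only [I, Finset.mem_filter, Finset.mem_univ, true_and] at hb
      exact hb.1 (mem_down.1 ha)
    · simp only [I, Finset.mem_filter, Finset.mem_univ, true_and] at hb
      rw [mem_down] at ha
      exact ⟨fun h => (hchain a b x h ha).elim hb.1 hb.2, fun h => hb.1 (htrans _ _ _ h ha)⟩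
  by_cases hP : m ≤ P.card
  · refine ⟨down R x, P, ?_, by omega, hP, Or.inr fun a ha b hb => ?_⟩
    · rw [Finset.disjoint_left]
      intro a ha hb
      simp only [P, Finset.mem_filter, Finset.mem_univ, true_and] at hb
      exact hb.1 (mem_down.1 ha)
    · simp only [P, Finset.mem_filter, Finset.mem_univ, true_and] at hb
      exact htrans _ _ _ (mem_down.1 ha) hb.2
  by_cases hC₂ : 2 * m ≤ C.card
  · obtain ⟨A, hAC, hA⟩ := Finset.exists_subset_card_eq (show m ≤ C.card by omega)
    have := Finset.card_sdiff_add_card_eq_card hAC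
    refine ⟨A, C \ A, Finset.disjoint_sdiff, hA.ge, by omega, Or.inr fun a ha b hb => ?_⟩
    have ha' := hAC ha
    have hb' := Finset.sdiff_subset hb
    simp only [C, Finset.mem_filter, Finset.mem_univ, true_and] at ha' hb'
    exact htrans _ _ _ ha'.1 hb'.2
  by_cases hC : m ≤ C.card
  · refine ⟨L, C, ?_, by omega, hC, Or.inr fun a ha b hb => ?_⟩
    · rw [Finset.disjoint_left]
      intro a ha hb
      simp only [L, C, Finset.mem_filter, Finset.mem_univ, true_and] at ha hb
      exact ha.2 hb.2
    · simp only [L, C, Finset.mem_filter, Finset.mem_univ, true_and] at ha hb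
      exact htrans _ _ _ ha.1 hb.2
  refine of_small L (fun z hz y hyz => ?_) (fun y hy => ?_) (by omega)
  · simp only [L, Finset.mem_filter, Finset.mem_univ, true_and] at hz ⊢
    exact ⟨htrans _ _ _ hyz hz.1, fun h => hz.2 (htrans _ _ _ h hyz)⟩
  · simp only [L, Finset.mem_filter, Finset.mem_univ, true_and] at hy
    by_contra! hge
    have heq := Finset.eq_of_subset_of_card_le (down_subset htrans hy.1) (hxmin y hge)
    exact hy.2 (mem_down.1 (heq ▸ mem_down.2 (hrefl x)))

end Outsimplicial


/-- Lemma on outsimplicial digraphs: if `D` is an outsimplicial digraph on `n > 1`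
vertices, then there are disjoint sets `A`, `B`, both of size at least `⌊n/6⌋`,
such that either there is no edge in either direction between `A` and `B`, or
there is a directed path from every vertex of `A` to every vertex of `B`. -/
theorem outsimplicial_lemma
    (V : Type) [Fintype V] (E : V → V → Prop)
    (hirr : ∀ v : V, ¬ E v v)
    (hout : ∀ u v w : V, v ≠ w → E u v → E u w → E v w ∨ E w v)
    (hn : 1 < Fintype.card V) :
    ∃ A B : Finset V, Disjoint A B ∧
      Fintype.card V / 6 ≤ A.card ∧
      Fintype.card V / 6 ≤ B.card ∧
      ((∀ a ∈ A, ∀ b ∈ B, ¬ E a b ∧ ¬ E b a) ∨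
       (∀ a ∈ A, ∀ b ∈ B, Relation.ReflTransGen E a b)) := by
  obtain ⟨A, B, h, hA, hB, hAB⟩ := Outsimplicial.exists_incomparable_or_below
    (R := Relation.ReflTransGen E) (fun _ => .refl) (fun _ _ _ => .trans)
    (fun _ _ _ => Outsimplicial.reachable_comparable hout) (Nat.mul_div_le (Fintype.card V) 6)
  exact ⟨A, B, h, hA, hB, hAB.imp_left fun h a ha b hb =>
    ⟨fun e => (h a ha b hb).1 (.single e), fun e => (h a ha b hb).2 (.single e)⟩⟩
end

section
/- For every tournament S on k ≥ 2 vertices and every positive integer ℓ, there exist a constant c > 0 and an integer n₀ such that every S-free tournament T on n ≥ n₀ vertices contains pairwise disjoint vertex subsets V₁, ..., V_ℓ with the following properties: |V_i| ≥ c·n for every i; and for all 1 ≤ i < j ≤ ℓ, every vertex of V_i has at most |V_j|/k inneighbors in V_j, and every vertex of V_j has at most |V_i|/k outneighbors in V_i. (That is, T contains a smooth (c, 1/k, w)-structure for the all-zero vector w of length ℓ.) -/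
/-- The number of pairs `(x, y)` in `X × Y` with `E y x`. -/
def backEdges {V : Type*} (E : V → V → Prop) [DecidableRel E] (X Y : Finset V) : ℕ :=
  ∑ x ∈ X, (Y.filter fun y => E y x).card

theorem backEdges_eq_sum_right {V : Type*} (E : V → V → Prop) [DecidableRel E]
    (X Y : Finset V) : backEdges E X Y = ∑ y ∈ Y, (X.filter fun x => E y x).card :=
  Finset.sum_card_bipartiteAbove_eq_sum_card_bipartiteBelow (fun x y => E y x)

theorem backEdges_mono_right {V : Type*} (E : V → V → Prop) [DecidableRel E]
    (X : Finset V) {Y Z : Finset V} (h : Y ⊆ Z) : backEdges E X Y ≤ backEdges E X Z :=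
  Finset.sum_le_sum fun _ _ => Finset.card_le_card (Finset.filter_subset_filter _ h)

theorem exists_pairwiseDisjoint_subsets_card_eq {ι V : Type*} [Fintype ι]
    (A : Finset V) (m : ℕ) (h : Fintype.card ι * m ≤ A.card) :
    ∃ B : ι → Finset V, (∀ i, B i ⊆ A) ∧ (∀ i, (B i).card = m) ∧
      ∀ i j, i ≠ j → Disjoint (B i) (B j) := by
  classical
  obtain ⟨g⟩ : Nonempty (ι × Fin m ↪ A) :=
    Function.Embedding.nonempty_of_card_le (by simpa using h)
  refine ⟨fun i => Finset.univ.image fun a => (g (i, a) : V), ?_, ?_, ?_⟩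
  · intro i x hx
    obtain ⟨a, -, rfl⟩ := Finset.mem_image.1 hx
    exact (g (i, a)).2
  · intro i
    rw [Finset.card_image_of_injective, Finset.card_univ, Fintype.card_fin]
    intro a b hab
    simpa using g.injective (Subtype.ext hab)
  · intro i j hij
    rw [Finset.disjoint_left]
    intro x hx hy
    obtain ⟨a, -, rfl⟩ := Finset.mem_image.1 hx
    obtain ⟨b, -, hb⟩ := Finset.mem_image.1 hy
    have := g.injective (Subtype.ext hb)
    simp only [Prod.mk.injEq] at this
    exact hij this.1.symm

/-- Greedy embedding: either the vertices in `s` can be placed in the candidate sets `B i`,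
or two candidate sets contain large subsets between which one direction is sparse. -/
theorem exists_partial_copy_or_sparse_pair {VS V : Type*} [Nonempty V]
    (ES : VS → VS → Prop) (hSirr : ∀ v, ¬ ES v v) (hStot : ∀ u v, u ≠ v → (ES u v ↔ ¬ ES v u))
    (E : V → V → Prop) [DecidableRel E] {ε : ℝ} (hε : 0 < ε) (hε1 : ε ≤ 1) (k : ℕ)
    (s : Finset VS) (hs : s.card ≤ k) (B : VS → Finset V) (hB : ∀ i ∈ s, (B i).Nonempty) :
    (∃ f : VS → V, (∀ i ∈ s, f i ∈ B i) ∧ ∀ i ∈ s, ∀ j ∈ s, ES i j → E (f i) (f j)) ∨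
    ∃ i ∈ s, ∃ j ∈ s, i ≠ j ∧ ∃ X ⊆ B i, ∃ Y ⊆ B j,
      ε ^ s.card * (B i).card ≤ k * X.card ∧ ε ^ s.card * (B j).card ≤ Y.card ∧
      ((∀ x ∈ X, ((Y.filter fun y => E y x).card : ℝ) ≤ ε * Y.card) ∨
        ∀ x ∈ X, ((Y.filter fun y => E x y).card : ℝ) ≤ ε * Y.card) := by
  classical
  induction s using Finset.induction_on generalizing B with
  | empty => exact Or.inl ⟨fun _ => Classical.arbitrary V, by simp, by simp⟩
  | insert a s ha ih =>
    rw [Finset.card_insert_of_notMem ha] at *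
    let N : V → VS → Finset V := fun v j =>
      (B j).filter fun y => if ES a j then E v y else E y v
    by_cases hgood : ∃ v ∈ B a, ∀ j ∈ s, ε * (B j).card < (N v j).card
    · obtain ⟨v, hv, hN⟩ := hgood
      have hNpos : ∀ j ∈ s, (N v j).Nonempty := fun j hj => by
        have h : (0 : ℝ) < (N v j).card := lt_of_le_of_lt (by positivity) (hN j hj)
        exact Finset.card_pos.1 (by exact_mod_cast h)
      have hsub : ∀ j, N v j ⊆ B j := fun j => Finset.filter_subset _ _
      have hpow : ∀ j ∈ s, ε ^ (s.card + 1) * (B j).card ≤ ε ^ s.card * (N v j).card :=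
        fun j hj => by
          rw [pow_succ, mul_assoc]
          exact mul_le_mul_of_nonneg_left (hN j hj).le (by positivity)
      rcases ih (by omega) (N v) hNpos with
        ⟨f, hf, hfE⟩ | ⟨i, hi, j, hj, hij, X, hX, Y, hY, h1, h2, h3⟩
      · left
        have hne : ∀ i ∈ s, i ≠ a := fun i hi h => ha (h ▸ hi)
        refine ⟨Function.update f a v, ?_, ?_⟩
        · intro i hi
          rcases Finset.mem_insert.1 hi with rfl | hi
          · simpa using hv
          · rw [Function.update_of_ne (hne i hi)]
            exact hsub i (hf i hi)
        · intro i hi j hj hij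
          rcases Finset.mem_insert.1 hi with rfl | hi' <;>
            rcases Finset.mem_insert.1 hj with rfl | hj'
          · exact absurd hij (hSirr _)
          · rw [Function.update_self, Function.update_of_ne (hne j hj')]
            have := (Finset.mem_filter.1 (hf j hj')).2
            rwa [if_pos hij] at this
          · rw [Function.update_self, Function.update_of_ne (hne i hi')]
            have := (Finset.mem_filter.1 (hf i hi')).2
            rwa [if_neg ((hStot _ _ (hne i hi')).1 hij)] at this
          · rw [Function.update_of_ne (hne i hi'), Function.update_of_ne (hne j hj')]
            exact hfE i hi' j hj' hij
      · right
        exact ⟨i, Finset.mem_insert_of_mem hi, j, Finset.mem_insert_of_mem hj, hij,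
          X, hX.trans (hsub i), Y, hY.trans (hsub j), (hpow i hi).trans h1,
          (hpow j hj).trans h2, h3⟩
    · right
      push Not at hgood
      have : Nonempty VS := ⟨a⟩
      choose! g hgs hg using hgood
      obtain ⟨v₀, hv₀⟩ := hB a (Finset.mem_insert_self a s)
      obtain ⟨j, hj, hcard⟩ : ∃ j ∈ s, (B a).card ≤
          k * ((B a).filter fun v => g v = j).card := by
        by_contra! hlt
        have hsum := Finset.card_eq_sum_card_fiberwise (f := g) (s := B a) (t := s)
          (fun v hv => hgs v hv)
        have hpos : 0 < (B a).card := Finset.card_pos.2 ⟨v₀, hv₀⟩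
        have h1 : k * (B a).card < s.card * (B a).card := by
          conv_lhs => rw [hsum, Finset.mul_sum]
          rw [← smul_eq_mul, ← Finset.sum_const]
          exact Finset.sum_lt_sum_of_nonempty ⟨_, hgs v₀ hv₀⟩ hlt
        have := lt_of_mul_lt_mul_right h1 (Nat.zero_le _)
        omega
      have hpow1 : ε ^ (s.card + 1) ≤ 1 := pow_le_one₀ hε.le hε1
      refine ⟨a, Finset.mem_insert_self a s, j, Finset.mem_insert_of_mem hj,
        fun h => ha (h ▸ hj), (B a).filter fun v => g v = j, Finset.filter_subset _ _,
        B j, Finset.Subset.refl _, ?_, mul_le_of_le_one_left (by positivity) hpow1, ?_⟩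
      · exact (mul_le_of_le_one_left (by positivity) hpow1).trans (by exact_mod_cast hcard)
      · have hx : ∀ x ∈ (B a).filter fun v => g v = j, ((N x j).card : ℝ) ≤ ε * (B j).card := by
          intro x hx
          obtain ⟨hxa, rfl⟩ := Finset.mem_filter.1 hx
          exact hg x hxa
        by_cases h : ES a j
        · right
          simpa only [N, h, if_true] using hx
        · left
          simpa only [N, h, if_false] using hx

/-- An `S`-free tournament contains, inside every large set `A`, two disjoint subsets of
linear size such that few edges point from the second one back to the first one. -/
theorem exists_sparse_pair_of_free {VS : Type*} [Fintype VS] [Nonempty VS] (ES : VS → VS → Prop)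
    (hSirr : ∀ v, ¬ ES v v) (hStot : ∀ u v, u ≠ v → (ES u v ↔ ¬ ES v u))
    {ε : ℝ} (hε : 0 < ε) :
    ∃ c : ℝ, 0 < c ∧ c ≤ 1 ∧ ∃ N : ℝ,
      ∀ (V : Type) (E : V → V → Prop) [DecidableRel E],
        (¬ ∃ f : VS → V, Function.Injective f ∧ ∀ u v, ES u v → E (f u) (f v)) →
        ∀ A : Finset V, N ≤ A.card → ∃ X ⊆ A, ∃ Y ⊆ A, Disjoint X Y ∧
          c * A.card ≤ X.card ∧ c * A.card ≤ Y.card ∧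
          (backEdges E X Y : ℝ) ≤ ε * X.card * Y.card := by
  classical
  wlog hε1 : ε ≤ 1 generalizing ε
  · obtain ⟨c, hc, hc1, N, h⟩ := this one_pos le_rfl
    refine ⟨c, hc, hc1, N, fun V E _ hfree A hA => ?_⟩
    obtain ⟨X, hX, Y, hY, hd, h1, h2, h3⟩ := h V E hfree A hA
    refine ⟨X, hX, Y, hY, hd, h1, h2, h3.trans ?_⟩
    gcongr
    exact (not_le.1 hε1).le
  set k := Fintype.card VS with hkdef
  have hk : 0 < k := Fintype.card_pos
  have hk' : (1 : ℝ) ≤ k := by exact_mod_cast hk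
  have hpow : 0 < ε ^ k := pow_pos hε k
  have hpow1 : ε ^ k ≤ 1 := pow_le_one₀ hε.le hε1
  refine ⟨ε ^ k / (k * (2 * k)), by positivity, ?_, k, fun V E _ hfree A hA => ?_⟩
  · rw [div_le_one (by positivity)]
    nlinarith
  have hA' : k ≤ A.card := by exact_mod_cast hA
  set m := A.card / k with hm
  have hm1 : 1 ≤ m := (Nat.one_le_div_iff hk).2 hA'
  have hmA : (A.card : ℝ) ≤ 2 * k * m := by
    have h1 : A.card < k * (m + 1) := Nat.lt_mul_div_succ _ hk
    have h2 : A.card ≤ 2 * k * m := by nlinarith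
    exact_mod_cast h2
  obtain ⟨B, hBA, hBm, hBd⟩ := exists_pairwiseDisjoint_subsets_card_eq (ι := VS) A m
    (by rw [← hkdef]; exact Nat.mul_div_le _ _)
  have : Nonempty V := by
    obtain ⟨v, -⟩ := Finset.card_pos.1 (hk.trans_le hA')
    exact ⟨v⟩
  rcases exists_partial_copy_or_sparse_pair ES hSirr hStot E hε hε1 k Finset.univ
      Finset.card_univ.le B (fun i _ => Finset.card_pos.1 (by rw [hBm]; omega)) with
    ⟨f, hf, hfE⟩ | ⟨i, -, j, -, hij, X, hX, Y, hY, h1, h2, h3⟩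
  · refine absurd ⟨f, fun u v huv => ?_, fun u v => hfE u (Finset.mem_univ _) v
      (Finset.mem_univ _)⟩ hfree
    by_contra hne
    exact Finset.disjoint_left.1 (hBd u v hne) (hf u (Finset.mem_univ _))
      (huv ▸ hf v (Finset.mem_univ _))
  · rw [Finset.card_univ, ← hkdef, hBm] at h1 h2
    have hbound : ε ^ k / (k * (2 * k)) * A.card ≤ ε ^ k * m / k := by
      calc ε ^ k / (k * (2 * k)) * A.card ≤ ε ^ k / (k * (2 * k)) * (2 * k * m) := by gcongr
        _ = ε ^ k * m / k := by field_simp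
    have hXc : ε ^ k / (k * (2 * k)) * A.card ≤ X.card :=
      hbound.trans ((div_le_iff₀' (by positivity)).2 h1)
    have hYc : ε ^ k / (k * (2 * k)) * A.card ≤ Y.card :=
      hbound.trans ((div_le_self (by positivity) hk').trans h2)
    have hd : Disjoint X Y := Finset.disjoint_of_subset_left hX
      (Finset.disjoint_of_subset_right hY (hBd i j hij))
    rcases h3 with h3 | h3
    · refine ⟨X, hX.trans (hBA i), Y, hY.trans (hBA j), hd, hXc, hYc, ?_⟩
      rw [backEdges, Nat.cast_sum]
      exact (Finset.sum_le_card_nsmul _ _ _ h3).trans_eq (by rw [nsmul_eq_mul]; ring)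
    · refine ⟨Y, hY.trans (hBA j), X, hX.trans (hBA i), hd.symm, hYc, hXc, ?_⟩
      rw [backEdges_eq_sum_right, Nat.cast_sum]
      exact (Finset.sum_le_card_nsmul _ _ _ h3).trans_eq (by rw [nsmul_eq_mul]; ring)

/-- Few back edges between `ℓ` disjoint linear-sized sets, on average. -/
theorem exists_sparse_sequence_of_free {VS : Type*} [Fintype VS] [Nonempty VS]
    (ES : VS → VS → Prop)
    (hSirr : ∀ v, ¬ ES v v) (hStot : ∀ u v, u ≠ v → (ES u v ↔ ¬ ES v u))
    {ε : ℝ} (hε : 0 < ε) (ℓ : ℕ) :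
    ∃ c : ℝ, 0 < c ∧ c ≤ 1 ∧ ∃ N : ℝ,
      ∀ (V : Type) (E : V → V → Prop) [DecidableRel E],
        (¬ ∃ f : VS → V, Function.Injective f ∧ ∀ u v, ES u v → E (f u) (f v)) →
        ∀ A : Finset V, N ≤ A.card → ∃ W : Fin ℓ → Finset V, (∀ i, W i ⊆ A) ∧
          (∀ i j, i < j → Disjoint (W i) (W j)) ∧
          (∀ i, c * A.card ≤ (W i).card) ∧
          ∀ i j, i < j → (backEdges E (W i) (W j) : ℝ) ≤ ε * (W i).card * (W j).card := by
  induction ℓ with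
  | zero =>
    exact ⟨1, one_pos, le_rfl, 0, fun V E _ _ A _ =>
      ⟨fun _ => ∅, fun i => i.elim0, fun i => i.elim0, fun i => i.elim0, fun i => i.elim0⟩⟩
  | succ ℓ ih =>
    obtain ⟨c, hc, hc1, N, h⟩ := ih
    obtain ⟨d, hd, hd1, M, hM⟩ := exists_sparse_pair_of_free ES hSirr hStot (mul_pos hε hc)
    refine ⟨c * d, by positivity, mul_le_one₀ hc1 hd.le hd1, max M (N / d),
      fun V E _ hfree A hA => ?_⟩
    obtain ⟨X, hX, Y, hY, hXY, hXc, hYc, hb⟩ := hM V E hfree A ((le_max_left _ _).trans hA)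
    have hNY : N ≤ Y.card := by
      have := (div_le_iff₀' hd).1 ((le_max_right _ _).trans hA)
      exact this.trans hYc
    obtain ⟨W, hWY, hWd, hWc, hWb⟩ := h V E hfree Y hNY
    refine ⟨Fin.cons X W, ?_, ?_, ?_, ?_⟩
    · intro i
      cases i using Fin.cases with
      | zero => exact hX
      | succ i => exact (hWY i).trans hY
    · intro i j hij
      cases j using Fin.cases with
      | zero => exact absurd hij (Fin.not_lt_zero i)
      | succ j =>
        cases i using Fin.cases with
        | zero => exact Finset.disjoint_of_subset_right (hWY j) hXY
        | succ i => exact hWd i j (Fin.succ_lt_succ_iff.1 hij)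
    · intro i
      cases i using Fin.cases with
      | zero =>
        refine le_trans ?_ hXc
        gcongr
        exact mul_le_of_le_one_left hd.le hc1
      | succ i =>
        refine le_trans ?_ (hWc i)
        rw [mul_assoc]
        gcongr
    · intro i j hij
      cases j using Fin.cases with
      | zero => exact absurd hij (Fin.not_lt_zero i)
      | succ j =>
        cases i using Fin.cases with
        | zero =>
          simp only [Fin.cons_zero, Fin.cons_succ]
          calc (backEdges E X (W j) : ℝ) ≤ backEdges E X Y := by
                exact_mod_cast backEdges_mono_right E X (hWY j)
            _ ≤ ε * c * X.card * Y.card := hb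
            _ = ε * X.card * (c * Y.card) := by ring
            _ ≤ ε * X.card * (W j).card := by
                gcongr
                exact hWc j
        | succ i => exact hWb i j (Fin.succ_lt_succ_iff.1 hij)

theorem card_filter_lt_le_of_sum_le {V : Type*} (W : Finset V) (D : V → ℕ) (M : ℕ) {ε t : ℝ}
    (ht : 0 < t) (hD : ∀ v ∈ W, D v ≤ M) (hsum : ((∑ v ∈ W, D v : ℕ) : ℝ) ≤ ε * W.card * M)
    (hε : 0 ≤ ε) :
    ((W.filter fun v => (M : ℝ) / t < D v).card : ℝ) ≤ t * ε * W.card := by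
  rcases Nat.eq_zero_or_pos M with rfl | hM
  · rw [Finset.filter_eq_empty_iff.2]
    · simp only [Finset.card_empty, Nat.cast_zero]
      positivity
    · intro v hv
      simp [Nat.le_zero.1 (hD v hv)]
  · have hM' : (0 : ℝ) < M := by exact_mod_cast hM
    have h1 : ((W.filter fun v => (M : ℝ) / t < D v).card : ℝ) * (M / t) ≤ ε * W.card * M := by
      refine le_trans ?_ hsum
      rw [Nat.cast_sum, ← nsmul_eq_mul]
      refine (Finset.card_nsmul_le_sum _ (fun v => (D v : ℝ)) _
        fun v hv => (Finset.mem_filter.1 hv).2.le).trans ?_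
      exact Finset.sum_le_sum_of_subset_of_nonneg (Finset.filter_subset _ _)
        fun _ _ _ => Nat.cast_nonneg _
    rw [mul_div_assoc', div_le_iff₀ ht] at h1
    refine le_of_mul_le_mul_right (h1.trans_eq ?_) hM'
    ring

/-- Deleting the atypical vertices turns average sparsity into sparsity at every vertex. -/
theorem exists_smooth_subsets {V : Type*} (E : V → V → Prop) [DecidableRel E] {k ℓ : ℕ}
    (hk : 0 < k) (hℓ : 0 < ℓ) (W : Fin ℓ → Finset V)
    (hW : ∀ i j, i < j →
      (backEdges E (W i) (W j) : ℝ) ≤ 1 / (4 * k * ℓ) * (W i).card * (W j).card) :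
    ∃ U : Fin ℓ → Finset V, (∀ i, U i ⊆ W i) ∧
      (∀ i, ((W i).card : ℝ) ≤ 2 * (U i).card) ∧
      ∀ i j, i < j →
        (∀ v ∈ U i, (((U j).filter fun x => E x v).card : ℝ) ≤ (U j).card / k) ∧
        ∀ v ∈ U j, (((U i).filter fun x => E v x).card : ℝ) ≤ (U i).card / k := by
  classical
  have hk' : (0 : ℝ) < k := by exact_mod_cast hk
  have hℓ' : (0 : ℝ) < ℓ := by exact_mod_cast hℓ
  let R : Fin ℓ → Fin ℓ → V → Finset V := fun i j v =>
    if i < j then (W j).filter fun x => E x v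
    else if j < i then (W j).filter fun x => E v x else ∅
  have hRW : ∀ i j v, R i j v ⊆ W j := by
    intro i j v
    simp only [R]
    split_ifs <;> simp
  have hRsum : ∀ i j, ((∑ v ∈ W i, (R i j v).card : ℕ) : ℝ) ≤
      1 / (4 * k * ℓ) * (W i).card * (W j).card := by
    intro i j
    rcases lt_trichotomy i j with h | rfl | h
    · simpa only [R, h, if_true, backEdges] using hW i j h
    · simp only [R, lt_irrefl, if_false, Finset.card_empty, Finset.sum_const_zero,
        Nat.cast_zero]
      positivity
    · have := hW j i h
      rw [backEdges_eq_sum_right] at this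
      simp only [R, h, h.not_gt, if_true, if_false]
      exact this.trans_eq (by ring)
  let bad : Fin ℓ → Fin ℓ → Finset V := fun i j =>
    (W i).filter fun v => ((W j).card : ℝ) / (2 * k) < (R i j v).card
  have hbad : ∀ i j, ((bad i j).card : ℝ) ≤ (W i).card / (2 * ℓ) := by
    intro i j
    refine (card_filter_lt_le_of_sum_le (W i) (fun v => (R i j v).card) (W j).card
      (by positivity) (fun v _ => Finset.card_le_card (hRW i j v)) (hRsum i j)
      (by positivity)).trans_eq ?_
    field_simp
    ring
  let U : Fin ℓ → Finset V := fun i => W i \ Finset.univ.biUnion (bad i)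
  have hUW : ∀ i, U i ⊆ W i := fun i => Finset.sdiff_subset
  have hUc : ∀ i, ((W i).card : ℝ) ≤ 2 * (U i).card := by
    intro i
    have h1 : ((Finset.univ.biUnion (bad i)).card : ℝ) ≤ (W i).card / 2 := by
      calc ((Finset.univ.biUnion (bad i)).card : ℝ) ≤ ∑ j, ((bad i j).card : ℝ) := by
            exact_mod_cast Finset.card_biUnion_le
        _ ≤ ∑ _j : Fin ℓ, ((W i).card : ℝ) / (2 * ℓ) := Finset.sum_le_sum fun j _ => hbad i j
        _ = (W i).card / 2 := by
            rw [Finset.sum_const, Finset.card_univ, Fintype.card_fin, nsmul_eq_mul]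
            field_simp
    have h2 : ((W i).card : ℝ) ≤ (Finset.univ.biUnion (bad i)).card + (U i).card := by
      have := Finset.card_le_card_sdiff_add_card (s := W i) (t := Finset.univ.biUnion (bad i))
      rw [add_comm] at this
      exact_mod_cast this
    linarith
  have hUR : ∀ i j, ∀ v ∈ U i, ((R i j v).card : ℝ) ≤ (U j).card / k := by
    intro i j v hv
    obtain ⟨hvW, hvb⟩ := Finset.mem_sdiff.1 hv
    have h1 : ((R i j v).card : ℝ) ≤ (W j).card / (2 * k) := by
      by_contra! h
      exact hvb (Finset.mem_biUnion.2
        ⟨j, Finset.mem_univ _, Finset.mem_filter.2 ⟨hvW, h⟩⟩)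
    refine h1.trans ?_
    rw [div_le_div_iff₀ (by positivity) hk']
    nlinarith [hUc j]
  refine ⟨U, hUW, hUc, fun i j hij => ⟨fun v hv => ?_, fun v hv => ?_⟩⟩
  · refine le_trans ?_ (hUR i j v hv)
    simp only [R, hij, if_true]
    exact_mod_cast Finset.card_le_card (Finset.filter_subset_filter _ (hUW j))
  · refine le_trans ?_ (hUR j i v hv)
    simp only [R, hij, hij.not_gt, if_true, if_false]
    exact_mod_cast Finset.card_le_card (Finset.filter_subset_filter _ (hUW i))


/-- For every tournament `S` on `k ≥ 2` vertices and every `ℓ > 0`, there exist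
`c > 0` and `n₀` such that every `S`-free tournament on `n ≥ n₀` vertices contains
a smooth `(c, 1/k, (0,…,0))`-structure: pairwise disjoint sets `V₁, …, V_ℓ`, each
of size at least `c·n`, such that for `i < j` every vertex of `Vᵢ` has at most
`|V_j|/k` inneighbors in `V_j` and every vertex of `V_j` has at most `|Vᵢ|/k`
outneighbors in `Vᵢ`. -/
theorem smooth_zero_structure_exists
    (k : ℕ) (hk : 2 ≤ k)
    (VS : Type) [Fintype VS] (ES : VS → VS → Prop)
    (hScard : Fintype.card VS = k)
    (hSirr : ∀ v : VS, ¬ ES v v)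
    (hStot : ∀ u v : VS, u ≠ v → (ES u v ↔ ¬ ES v u))
    (ℓ : ℕ) (hℓ : 0 < ℓ) :
    ∃ c : ℝ, 0 < c ∧ ∃ n₀ : ℕ,
      ∀ (V : Type) [Fintype V] [DecidableEq V] (E : V → V → Prop) [DecidableRel E],
        (∀ v : V, ¬ E v v) →
        (∀ u v : V, u ≠ v → (E u v ↔ ¬ E v u)) →
        n₀ ≤ Fintype.card V →
        (¬ ∃ f : VS → V, Function.Injective f ∧ ∀ u v : VS, ES u v → E (f u) (f v)) →
        ∃ Vs : Fin ℓ → Finset V,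
          (∀ i j : Fin ℓ, i ≠ j → Disjoint (Vs i) (Vs j)) ∧
          (∀ i : Fin ℓ, c * (Fintype.card V : ℝ) ≤ ((Vs i).card : ℝ)) ∧
          (∀ i j : Fin ℓ, i < j →
            (∀ v ∈ Vs i,
              ((((Vs j).filter (fun x => E x v)).card : ℝ) ≤ ((Vs j).card : ℝ) / k)) ∧
            (∀ v ∈ Vs j,
              ((((Vs i).filter (fun x => E v x)).card : ℝ) ≤ ((Vs i).card : ℝ) / k))) := by
  have hk0 : 0 < k := by omega
  have : Nonempty VS := Fintype.card_pos_iff.1 (by omega)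
  have hk' : (0 : ℝ) < k := by exact_mod_cast hk0
  have hℓ' : (0 : ℝ) < ℓ := by exact_mod_cast hℓ
  obtain ⟨c, hc, -, N, h⟩ := exists_sparse_sequence_of_free ES hSirr hStot
    (ε := 1 / (4 * k * ℓ)) (by positivity) ℓ
  refine ⟨c / 2, by positivity, ⌈N⌉₊, fun V _ _ E _ _ _ hn hfree => ?_⟩
  obtain ⟨W, -, hWd, hWc, hWb⟩ := h V E hfree Finset.univ (Nat.ceil_le.1 hn)
  obtain ⟨U, hUW, hUc, hU⟩ := exists_smooth_subsets E hk0 hℓ W hWb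
  refine ⟨U, fun i j hij => ?_, fun i => ?_, hU⟩
  · refine Finset.disjoint_of_subset_left (hUW i) (Finset.disjoint_of_subset_right (hUW j) ?_)
    rcases hij.lt_or_gt with h | h
    · exact hWd i j h
    · exact (hWd j i h).symm
  · have h1 := hWc i
    have h2 := hUc i
    rw [Finset.card_univ] at h1
    linarith
end

section
/- Let S be a tournament, let w be a {0,1}-vector of length ℓ, and let 0 < λ < 1/2 be a constant. Then there exist ε > 0 and c > 0 such that every S-free ε-critical tournament T contains a smooth (c, λ, w)-structure, i.e., pairwise disjoint subsets S₁, ..., S_ℓ of V(T) such that: whenever w_i = 0, |S_i| ≥ c·|V(T)|; whenever w_i = 1, the relation → restricted to S_i is transitive and |S_i| ≥ c·tr(T); and for all 1 ≤ i < j ≤ ℓ, every vertex of S_i has at most λ·|S_j| inneighbors in S_j and every vertex of S_j has at most λ·|S_i| outneighbors in S_i. -/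
/-- A finset `A` is transitive for the relation `E`. -/
def IsTransOn {V : Type} (E : V → V → Prop) (A : Finset V) : Prop :=
  ∀ a ∈ A, ∀ b ∈ A, ∀ c ∈ A, E a b → E b c → E a c

open Classical in
/-- `trSub E W` is the largest size of a subset of `W` on which `E` is transitive
(the size of a largest transitive subtournament of the subtournament induced on `W`). -/
noncomputable def trSub {V : Type} [Fintype V] [DecidableEq V]
    (E : V → V → Prop) (W : Finset V) : ℕ :=
  W.powerset.sup (fun A => if IsTransOn E A then A.card else 0)

section

open Finset

/-- A largest transitive subset exists. -/
lemma exists_card_eq_trSub {V : Type} [Fintype V] [DecidableEq V] (E : V → V → Prop)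
    (W : Finset V) : ∃ A ⊆ W, IsTransOn E A ∧ A.card = trSub E W := by
  classical
  obtain ⟨A, hA, h⟩ := Finset.exists_mem_eq_sup W.powerset ⟨∅, by simp⟩
    (fun A => if IsTransOn E A then A.card else 0)
  by_cases hT : IsTransOn E A
  · refine ⟨A, by simpa using hA, hT, ?_⟩
    rw [if_pos hT] at h
    rw [← h]
    unfold trSub
    congr!
  · refine ⟨∅, by simp, by simp [IsTransOn], ?_⟩
    rw [if_neg hT] at h
    rw [card_empty, ← h]
    unfold trSub
    congr!

lemma card_le_trSub {V : Type} [Fintype V] [DecidableEq V] {E : V → V → Prop}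
    {A W : Finset V} (hA : A ⊆ W) (hT : IsTransOn E A) : A.card ≤ trSub E W := by
  classical
  unfold trSub
  refine le_trans (by rw [if_pos hT]) (Finset.le_sup
    (f := fun A => if IsTransOn E A then A.card else 0) (mem_powerset.mpr hA))

/-- Markov's inequality for the degrees in a bipartite relation. -/
lemma card_filter_lt_degree_mul_le {α β : Type} (P : α → β → Prop) [∀ a, DecidablePred (P a)]
    [∀ b, DecidablePred (fun a => P a b)]
    (X : Finset α) (Y : Finset β) {a b : ℝ} (hX : X.Nonempty)
    (h : ∀ x ∈ X, ((Y.filter (P x)).card : ℝ) ≤ a * Y.card) :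
    ((Y.filter (fun y => b * X.card < ((X.filter (fun x => P x y)).card : ℝ))).card : ℝ) * b
      ≤ a * Y.card := by
  set B := Y.filter (fun y => b * X.card < ((X.filter (fun x => P x y)).card : ℝ)) with hB
  have hXpos : (0 : ℝ) < X.card := by exact_mod_cast hX.card_pos
  have hdouble : ∑ x ∈ X, ((Y.filter (P x)).card : ℝ)
      = ∑ y ∈ Y, ((X.filter (fun x => P x y)).card : ℝ) := by
    exact_mod_cast Finset.sum_card_bipartiteAbove_eq_sum_card_bipartiteBelow P
  have hupper : ∑ x ∈ X, ((Y.filter (P x)).card : ℝ) ≤ X.card * (a * Y.card) := by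
    simpa using Finset.sum_le_card_nsmul X _ _ h
  have hlower : (B.card : ℝ) * (b * X.card) ≤ ∑ y ∈ B, ((X.filter (fun x => P x y)).card : ℝ) := by
    simpa using Finset.card_nsmul_le_sum B _ (b * X.card)
      (fun y hy => (le_of_lt (mem_filter.mp hy).2))
  have hsub : ∑ y ∈ B, ((X.filter (fun x => P x y)).card : ℝ)
      ≤ ∑ y ∈ Y, ((X.filter (fun x => P x y)).card : ℝ) :=
    Finset.sum_le_sum_of_subset_of_nonneg (filter_subset _ _) (fun _ _ _ => by positivity)
  refine le_of_mul_le_mul_right ?_ hXpos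
  nlinarith

/-- One-sided sparseness becomes two-sided after passing to half of the second side. -/
lemma exists_subset_two_sided {α β : Type} (P : α → β → Prop) [∀ a, DecidablePred (P a)]
    [∀ b, DecidablePred (fun a => P a b)]
    (X : Finset α) (Y : Finset β) {δ : ℝ} (hδ : 0 < δ) (hX : X.Nonempty)
    (h : ∀ x ∈ X, ((Y.filter (P x)).card : ℝ) ≤ δ * Y.card) :
    ∃ Z ⊆ Y, (Y.card : ℝ) ≤ 2 * Z.card ∧
      (∀ x ∈ X, ((Z.filter (P x)).card : ℝ) ≤ 2 * δ * Z.card) ∧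
      (∀ y ∈ Z, ((X.filter (fun x => P x y)).card : ℝ) ≤ 2 * δ * X.card) := by
  have hm := card_filter_lt_degree_mul_le P X Y (b := 2 * δ) hX h
  have hsplit := Finset.card_filter_add_card_filter_not (s := Y)
    (fun y => 2 * δ * X.card < ((X.filter (fun x => P x y)).card : ℝ))
  set Z := Y.filter (fun y => ¬ 2 * δ * X.card < ((X.filter (fun x => P x y)).card : ℝ))
  set B := Y.filter (fun y => 2 * δ * X.card < ((X.filter (fun x => P x y)).card : ℝ))
  have hsplit' : (B.card : ℝ) + Z.card = Y.card := by exact_mod_cast hsplit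
  have hB : 2 * (B.card : ℝ) ≤ Y.card := by
    refine le_of_mul_le_mul_right ?_ hδ
    linarith
  have hZ : (Y.card : ℝ) ≤ 2 * Z.card := by linarith
  refine ⟨Z, filter_subset _ _, hZ, fun x hx => ?_, fun y hy => not_lt.mp (mem_filter.mp hy).2⟩
  have h1 : ((Z.filter (P x)).card : ℝ) ≤ (Y.filter (P x)).card := by
    exact_mod_cast card_le_card (filter_subset_filter _ (filter_subset _ _))
  nlinarith [h x hx]

/-- Either a prescribed tournament embeds with its vertices in prescribed sets, or there is a
large sparse pair. -/
lemma exists_embedding_or_sparse_pair {VS : Type} [DecidableEq VS] (ES : VS → VS → Prop)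
    (hSirr : ∀ v : VS, ¬ ES v v) (hSasymm : ∀ u v : VS, ES u v → ¬ ES v u)
    {δ : ℝ} (hδ : 0 < δ) (U : Finset VS) :
    ∃ c : ℝ, 0 < c ∧ ∀ (V : Type) [DecidableEq V] [Nonempty V] (E : V → V → Prop)
      [DecidableRel E] (A : VS → Finset V), (∀ v ∈ U, (A v).Nonempty) →
      (∃ f : VS → V, (∀ v ∈ U, f v ∈ A v) ∧ ∀ u ∈ U, ∀ v ∈ U, ES u v → E (f u) (f v)) ∨
      ∃ u ∈ U, ∃ v ∈ U, u ≠ v ∧ ∃ X ⊆ A u, ∃ Y ⊆ A v, c * (A u).card ≤ X.card ∧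
        c * (A v).card ≤ Y.card ∧
        ((∀ x ∈ X, ((Y.filter (fun y => E x y)).card : ℝ) ≤ δ * Y.card) ∨
         (∀ x ∈ X, ((Y.filter (fun y => E y x)).card : ℝ) ≤ δ * Y.card)) := by
  classical
  induction U using Finset.induction_on with
  | empty =>
    refine ⟨1, one_pos, fun V _ _ E _ A _ => Or.inl ⟨fun _ => Classical.arbitrary V, ?_, ?_⟩⟩ <;>
      simp
  | insert u U hu ih =>
    obtain ⟨c, hc, ih⟩ := ih
    refine ⟨min (min 1 (1 / (U.card + 1))) (c * min 1 δ), by positivity, ?_⟩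
    intro V _ _ E _ A hA
    have hcm1 : min (min 1 (1 / ((U.card : ℝ) + 1))) (c * min 1 δ) ≤ 1 :=
      (min_le_left _ _).trans (min_le_left _ _)
    have hcm2 : min (min 1 (1 / ((U.card : ℝ) + 1))) (c * min 1 δ) ≤ 1 / ((U.card : ℝ) + 1) :=
      (min_le_left _ _).trans (min_le_right _ _)
    have hcm3 : min (min 1 (1 / ((U.card : ℝ) + 1))) (c * min 1 δ) ≤ c * δ :=
      (min_le_right _ _).trans (by gcongr; exact min_le_right _ _)
    have hcm4 : min (min 1 (1 / ((U.card : ℝ) + 1))) (c * min 1 δ) ≤ c :=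
      (min_le_right _ _).trans (by nlinarith [min_le_left 1 δ])
    set c' := min (min 1 (1 / ((U.card : ℝ) + 1))) (c * min 1 δ)
    let N : VS → V → Finset V := fun v x =>
      if ES u v then (A v).filter (fun y => E x y) else (A v).filter (fun y => E y x)
    let B : VS → Finset V := fun v =>
      (A u).filter (fun x => ((N v x).card : ℝ) ≤ δ * (A v).card)
    have hAu : (A u).Nonempty := hA u (mem_insert_self _ _)
    have hAupos : (0 : ℝ) < (A u).card := by exact_mod_cast hAu.card_pos
    by_cases hbad : ∃ v ∈ U, c' * (A u).card ≤ ((B v).card : ℝ)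
    · obtain ⟨v, hv, hBv⟩ := hbad
      right
      refine ⟨u, mem_insert_self _ _, v, mem_insert_of_mem hv, fun h => hu (h ▸ hv),
        B v, filter_subset _ _, A v, Subset.refl _, hBv, ?_, ?_⟩
      · nlinarith [(Nat.cast_nonneg (A v).card : (0 : ℝ) ≤ _)]
      · by_cases huv : ES u v
        · left
          intro x hx
          have := (mem_filter.mp hx).2
          simpa only [N, if_pos huv] using this
        · right
          intro x hx
          have := (mem_filter.mp hx).2
          simpa only [N, if_neg huv] using this
    · push Not at hbad
      have hgood : ∃ x ∈ A u, ∀ v ∈ U, x ∉ B v := by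
        by_contra! hcon
        have hcov : A u ⊆ U.biUnion B := fun x hx => by
          obtain ⟨v, hv, hxv⟩ := hcon x hx
          exact mem_biUnion.mpr ⟨v, hv, hxv⟩
        have h1 : ((A u).card : ℝ) ≤ ∑ v ∈ U, ((B v).card : ℝ) := by
          exact_mod_cast (card_le_card hcov).trans card_biUnion_le
        have h2 : ∑ v ∈ U, ((B v).card : ℝ) ≤ U.card * (c' * (A u).card) := by
          simpa using Finset.sum_le_card_nsmul U _ _ (fun v hv => (hbad v hv).le)
        have h3 : c' * ((U.card : ℝ) + 1) ≤ 1 := by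
          rwa [le_div_iff₀ (by positivity)] at hcm2
        have h4 : 0 < c' := by positivity
        nlinarith [mul_le_mul_of_nonneg_right h3 hAupos.le, mul_pos h4 hAupos]
      obtain ⟨x, hx, hxB⟩ := hgood
      have hNsub : ∀ v, N v x ⊆ A v := fun v => by
        by_cases huv : ES u v
        · simp only [N, if_pos huv]; exact filter_subset _ _
        · simp only [N, if_neg huv]; exact filter_subset _ _
      have hNcard : ∀ v ∈ U, δ * (A v).card < ((N v x).card : ℝ) := fun v hv => by
        by_contra! hle
        exact hxB v hv (mem_filter.mpr ⟨hx, hle⟩)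
      have hNne : ∀ v ∈ U, (N v x).Nonempty := fun v hv => by
        rw [← card_pos]
        have : (0 : ℝ) < (N v x).card := lt_of_le_of_lt (by positivity) (hNcard v hv)
        exact_mod_cast this
      rcases ih V E (fun v => N v x) hNne with
        ⟨f, hf, hfE⟩ | ⟨a, ha, b, hb, hab, X, hX, Y, hY, h1, h2, h3⟩
      · left
        refine ⟨Function.update f u x, ?_, ?_⟩
        · intro v hv
          rcases mem_insert.mp hv with rfl | hv
          · simpa using hx
          · rw [Function.update_of_ne (ne_of_mem_of_not_mem hv hu)]
            exact hNsub v (hf v hv)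
        · intro a ha b hb hab
          rcases mem_insert.mp ha with rfl | ha' <;> rcases mem_insert.mp hb with rfl | hb'
          · exact absurd hab (hSirr _)
          · rw [Function.update_self, Function.update_of_ne (ne_of_mem_of_not_mem hb' hu)]
            have := hf b hb'
            simp only [N, if_pos hab] at this
            exact (mem_filter.mp this).2
          · rw [Function.update_self, Function.update_of_ne (ne_of_mem_of_not_mem ha' hu)]
            have := hf a ha'
            simp only [N, if_neg (hSasymm _ _ hab)] at this
            exact (mem_filter.mp this).2
          · rw [Function.update_of_ne (ne_of_mem_of_not_mem ha' hu),
              Function.update_of_ne (ne_of_mem_of_not_mem hb' hu)]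
            exact hfE a ha' b hb' hab
      · right
        have key : ∀ v ∈ U, c' * (A v).card ≤ c * (N v x).card := fun v hv => by
          have := hNcard v hv
          have h5 : (0 : ℝ) ≤ (A v).card := by positivity
          nlinarith
        exact ⟨a, mem_insert_of_mem ha, b, mem_insert_of_mem hb, hab, X, hX.trans (hNsub a),
          Y, hY.trans (hNsub b), (key a ha).trans h1, (key b hb).trans h2, h3⟩

/-- A large finset contains pairwise disjoint finsets of proportional size, indexed by a given
finite type. -/
lemma exists_disjoint_family (VS : Type) [Fintype VS] [Nonempty VS] {V : Type} [DecidableEq V]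
    (W : Finset V) (hW : Fintype.card VS ≤ W.card) :
    ∃ A : VS → Finset V, (∀ v, A v ⊆ W) ∧ (∀ u v, u ≠ v → Disjoint (A u) (A v)) ∧
      ∀ v, (W.card : ℝ) ≤ 2 * Fintype.card VS * (A v).card := by
  classical
  set h := Fintype.card VS
  have hpos : 0 < h := Fintype.card_pos
  set m := W.card / h
  have hcard : Fintype.card (VS × Fin m) ≤ Fintype.card W := by
    simp only [Fintype.card_prod, Fintype.card_fin, Fintype.card_coe]
    exact Nat.mul_div_le _ _
  obtain ⟨g⟩ := Function.Embedding.nonempty_of_card_le hcard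
  refine ⟨fun v => univ.image (fun i : Fin m => (g (v, i) : V)), ?_, ?_, ?_⟩
  · intro v x hx
    obtain ⟨i, -, rfl⟩ := mem_image.mp hx
    exact (g (v, i)).2
  · intro u v huv
    rw [Finset.disjoint_left]
    intro x hx hx'
    obtain ⟨i, -, rfl⟩ := mem_image.mp hx
    obtain ⟨j, -, hj⟩ := mem_image.mp hx'
    have := g.injective (Subtype.ext hj)
    exact huv (Prod.ext_iff.mp this).1.symm
  · intro v
    have hinj : Function.Injective (fun i : Fin m => (g (v, i) : V)) := fun i j hij => by
      have := g.injective (Subtype.ext hij)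
      exact (Prod.ext_iff.mp this).2
    rw [card_image_of_injective _ hinj, card_univ, Fintype.card_fin]
    have h1 : W.card < h * (m + 1) := Nat.lt_mul_div_succ _ hpos
    have h2 : 1 ≤ m := (Nat.one_le_div_iff hpos).mpr hW
    have h3 : W.card ≤ 2 * h * m := by nlinarith
    exact_mod_cast h3

/-- Large vertex sets in `S`-free tournaments contain a large sparse pair. -/
lemma exists_sparse_pair (VS : Type) [Fintype VS] (ES : VS → VS → Prop)
    (hSirr : ∀ v : VS, ¬ ES v v) (hSasymm : ∀ u v : VS, ES u v → ¬ ES v u)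
    {δ : ℝ} (hδ : 0 < δ) :
    ∃ c : ℝ, 0 < c ∧ ∀ (V : Type) [DecidableEq V] (E : V → V → Prop) [DecidableRel E],
      (¬ ∃ f : VS → V, Function.Injective f ∧ ∀ u v : VS, ES u v → E (f u) (f v)) →
      ∀ W : Finset V, W.Nonempty → Fintype.card VS ≤ W.card →
      ∃ X ⊆ W, ∃ Y ⊆ W, Disjoint X Y ∧ c * W.card ≤ X.card ∧ c * W.card ≤ Y.card ∧
        (∀ x ∈ X, ((Y.filter (fun y => E y x)).card : ℝ) ≤ δ * Y.card) ∧
        (∀ y ∈ Y, ((X.filter (fun x => E y x)).card : ℝ) ≤ δ * X.card) := by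
  classical
  obtain ⟨c, hc, H⟩ := exists_embedding_or_sparse_pair ES hSirr hSasymm (half_pos hδ) univ
  rcases isEmpty_or_nonempty VS with hVS | hVS
  · refine ⟨1, one_pos, fun V _ E _ hfree => absurd ⟨fun v => hVS.elim v, ?_, ?_⟩ hfree⟩
    · exact fun v => hVS.elim v
    · exact fun v => hVS.elim v
  have hh : (0 : ℝ) < Fintype.card VS := by exact_mod_cast Fintype.card_pos
  refine ⟨c / (4 * Fintype.card VS), by positivity, ?_⟩
  intro V _ E _ hfree W hWne hW
  have hVne : Nonempty V := ⟨hWne.choose⟩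
  have hWpos : (0 : ℝ) < W.card := by exact_mod_cast hWne.card_pos
  obtain ⟨A, hAW, hdisj, hAcard⟩ := exists_disjoint_family VS W hW
  have hApos : ∀ v, (0 : ℝ) < (A v).card := fun v => by
    by_contra! hle
    have := hAcard v
    nlinarith
  have hscale : ∀ v, c / (4 * Fintype.card VS) * W.card ≤ c * (A v).card / 2 := fun v => by
    have := hAcard v
    rw [div_mul_eq_mul_div, div_le_iff₀ (by positivity)]
    nlinarith
  rcases H V E A (fun v _ => card_pos.mp (by exact_mod_cast hApos v)) with
    ⟨f, hf, hfE⟩ | ⟨u, -, v, -, huv, X, hX, Y, hY, h1, h2, h3⟩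
  · refine absurd ⟨f, fun a b hab => ?_, fun u v => hfE u (mem_univ _) v (mem_univ _)⟩ hfree
    by_contra hne
    exact Finset.disjoint_left.mp (hdisj a b hne) (hf a (mem_univ _)) (hab ▸ hf b (mem_univ _))
  have hXpos : (0 : ℝ) < X.card := lt_of_lt_of_le (mul_pos hc (hApos u)) h1
  have hXne : X.Nonempty := card_pos.mp (by exact_mod_cast hXpos)
  have hXY : Disjoint X Y := (hdisj u v huv).mono hX hY
  have hsu := hscale u
  have hsv := hscale v
  rcases h3 with h3 | h3
  · obtain ⟨Z, hZ, hZc, hXZ, hZX⟩ := exists_subset_two_sided E X Y (half_pos hδ) hXne h3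
    rw [mul_div_cancel₀ δ two_ne_zero] at hXZ hZX
    exact ⟨Z, (hZ.trans hY).trans (hAW v), X, hX.trans (hAW u), (hXY.mono_right hZ).symm,
      by linarith, by linarith, hZX, hXZ⟩
  · obtain ⟨Z, hZ, hZc, hXZ, hZX⟩ :=
      exists_subset_two_sided (fun x y => E y x) X Y (half_pos hδ) hXne h3
    rw [mul_div_cancel₀ δ two_ne_zero] at hXZ hZX
    exact ⟨X, hX.trans (hAW u), Z, (hZ.trans hY).trans (hAW v), hXY.mono_right hZ,
      by linarith, by linarith, hXZ, hZX⟩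

/-- Structures in which each later vertex sends few edges to each earlier set. -/
lemma exists_one_sided_structure (VS : Type) [Fintype VS] (ES : VS → VS → Prop)
    (hSirr : ∀ v : VS, ¬ ES v v) (hSasymm : ∀ u v : VS, ES u v → ¬ ES v u)
    {δ : ℝ} (hδ : 0 < δ) (ℓ : ℕ) (w : Fin ℓ → Fin 2) :
    ∃ c N : ℝ, 0 < c ∧ c ≤ 1 ∧ ∀ (V : Type) [Fintype V] [DecidableEq V] (E : V → V → Prop)
      [DecidableRel E],
      (¬ ∃ f : VS → V, Function.Injective f ∧ ∀ u v : VS, ES u v → E (f u) (f v)) →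
      ∀ ε : ℝ, 0 < ε →
      (∀ W : Finset V, W ⊂ univ → ((W.card : ℝ) ^ ε ≤ (trSub E W : ℝ))) →
      ∀ W : Finset V, W.Nonempty → N ≤ W.card →
      ∃ Ss : Fin ℓ → Finset V, (∀ i, Ss i ⊆ W) ∧ (∀ i j, i ≠ j → Disjoint (Ss i) (Ss j)) ∧
        (∀ i, w i = 0 → c * W.card ≤ ((Ss i).card : ℝ)) ∧
        (∀ i, w i = 1 → IsTransOn E (Ss i) ∧ (c * W.card) ^ ε ≤ ((Ss i).card : ℝ)) ∧
        (∀ i j, i < j → ∀ v ∈ Ss j,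
          (((Ss i).filter (fun x => E v x)).card : ℝ) ≤ δ * (Ss i).card) := by
  induction ℓ with
  | zero =>
    refine ⟨1, 0, one_pos, le_rfl, fun V _ _ E _ _ ε _ _ W _ _ => ⟨fun _ => ∅, ?_⟩⟩
    exact ⟨fun i => i.elim0, fun i => i.elim0, fun i => i.elim0, fun i => i.elim0,
      fun i => i.elim0⟩
  | succ k ih =>
    obtain ⟨c₀, N₀, hc₀, hc₀1, ih⟩ := ih (fun i => w i.succ)
    obtain ⟨c₁, hc₁, hpair⟩ := exists_sparse_pair VS ES hSirr hSasymm (half_pos hδ)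
    refine ⟨min c₀ (min c₁ (c₀ * (c₁ / 2))), max (Fintype.card VS) (N₀ / (c₁ / 2)),
      by positivity, (min_le_left _ _).trans hc₀1, ?_⟩
    intro V _ _ E _ hfree ε hε hcrit W hWne hWN
    have hcc₁ : min c₀ (min c₁ (c₀ * (c₁ / 2))) ≤ c₁ := (min_le_right _ _).trans (min_le_left _ _)
    have hcc₀ : min c₀ (min c₁ (c₀ * (c₁ / 2))) ≤ c₀ * (c₁ / 2) :=
      (min_le_right _ _).trans (min_le_right _ _)
    have hcpos : 0 < min c₀ (min c₁ (c₀ * (c₁ / 2))) := by positivity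
    set c := min c₀ (min c₁ (c₀ * (c₁ / 2)))
    have hWpos : (0 : ℝ) < W.card := by exact_mod_cast hWne.card_pos
    have hWVS : Fintype.card VS ≤ W.card := by exact_mod_cast (le_max_left _ _).trans hWN
    have hWN₀ : N₀ ≤ c₁ / 2 * W.card := by
      have := (le_max_right _ _).trans hWN
      rwa [div_le_iff₀ (by positivity), mul_comm] at this
    obtain ⟨X, hX, Y, hY, hXY, hXc, hYc, hXsparse, hYsparse⟩ := hpair V E hfree W hWne hWVS
    have hYne : Y.Nonempty := card_pos.mp (by
      have : (0 : ℝ) < Y.card := lt_of_lt_of_le (by positivity) hYc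
      exact_mod_cast this)
    have hfirst : ∃ A ⊆ X, ∃ Z ⊆ Y, (Y.card : ℝ) ≤ 2 * Z.card ∧
        (w 0 = 0 → c * W.card ≤ (A.card : ℝ)) ∧
        (w 0 = 1 → IsTransOn E A ∧ (c * W.card) ^ ε ≤ (A.card : ℝ)) ∧
        (∀ v ∈ Z, ((A.filter (fun x => E v x)).card : ℝ) ≤ δ * A.card) := by
      by_cases hw : w 0 = 0
      · refine ⟨X, Subset.refl _, Y, Subset.refl _,
          by linarith [(Nat.cast_nonneg Y.card : (0 : ℝ) ≤ _)],
          fun _ => ?_, fun h => by simp [hw] at h, fun v hv => ?_⟩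
        · exact (mul_le_mul_of_nonneg_right hcc₁ hWpos.le).trans hXc
        · have := hYsparse v hv
          have h5 : (0 : ℝ) ≤ X.card := by positivity
          nlinarith
      · have hXss : X ⊂ univ := by
          obtain ⟨y, hy⟩ := hYne
          exact (ssubset_univ_iff).mpr fun h =>
            Finset.disjoint_left.mp hXY (h ▸ mem_univ y) hy
        obtain ⟨A, hA, hAT, hAc⟩ := exists_card_eq_trSub E X
        have hAlarge : (c * W.card) ^ ε ≤ (A.card : ℝ) := by
          rw [hAc]
          refine le_trans ?_ (hcrit X hXss)
          refine Real.rpow_le_rpow (by positivity) ?_ hε.le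
          exact (mul_le_mul_of_nonneg_right hcc₁ hWpos.le).trans hXc
        have hAne : A.Nonempty := card_pos.mp (by
          have : (0 : ℝ) < A.card := lt_of_lt_of_le (by positivity) hAlarge
          exact_mod_cast this)
        obtain ⟨Z, hZ, hZc, -, hZA⟩ := exists_subset_two_sided (fun x y => E y x) A Y
          (half_pos hδ) hAne (fun x hx => hXsparse x (hA hx))
        rw [mul_div_cancel₀ δ two_ne_zero] at hZA
        exact ⟨A, hA, Z, hZ, hZc, fun h => absurd h hw, fun _ => ⟨hAT, hAlarge⟩, hZA⟩
    obtain ⟨A, hA, Z, hZ, hZc, hA0, hA1, hZA⟩ := hfirst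
    have hZW : c₁ / 2 * W.card ≤ Z.card := by linarith
    have hZne : Z.Nonempty := card_pos.mp (by
      have : (0 : ℝ) < Z.card := lt_of_lt_of_le (by positivity) hZW
      exact_mod_cast this)
    obtain ⟨Ss, hSsub, hSdisj, hS0, hS1, hSs⟩ :=
      ih V E hfree ε hε hcrit Z hZne (hWN₀.trans hZW)
    have hscale : c * W.card ≤ c₀ * Z.card := by nlinarith
    have hAS : ∀ i, Disjoint A (Ss i) := fun i => hXY.mono hA ((hSsub i).trans hZ)
    refine ⟨Fin.cons A Ss, ?_, ?_, ?_, ?_, ?_⟩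
    · intro i
      refine Fin.cases ?_ (fun i => ?_) i
      · exact hA.trans hX
      · exact ((hSsub i).trans hZ).trans hY
    · intro i j
      refine Fin.cases ?_ (fun i => ?_) i <;> refine Fin.cases ?_ (fun j => ?_) j
      · exact fun h => absurd rfl h
      · exact fun _ => hAS j
      · exact fun _ => (hAS i).symm
      · exact fun h => hSdisj i j (fun hij => h (by rw [hij]))
    · intro i
      refine Fin.cases hA0 (fun i hi => ?_) i
      exact hscale.trans (hS0 i hi)
    · intro i
      refine Fin.cases hA1 (fun i hi => ?_) i
      exact ⟨(hS1 i hi).1, (Real.rpow_le_rpow (by positivity) hscale hε.le).trans (hS1 i hi).2⟩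
    · intro i j
      refine Fin.cases ?_ (fun i => ?_) i <;> refine Fin.cases ?_ (fun j => ?_) j
      · exact fun h => absurd h (lt_irrefl _)
      · exact fun _ v hv => hZA v (hSsub j hv)
      · exact fun h => absurd h (by simp)
      · exact fun h => hSs i j (Fin.succ_lt_succ_iff.mp h)

/-- One-sided structures contain two-sided ones on at least half of each set. -/
lemma exists_two_sided_structure {V : Type} (E : V → V → Prop) [DecidableRel E] {ℓ : ℕ}
    (Ss : Fin ℓ → Finset V) (hne : ∀ i, (Ss i).Nonempty) {lam : ℝ} (hlam : 0 < lam)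
    (h : ∀ i j, i < j → ∀ v ∈ Ss j,
      (((Ss i).filter (fun x => E v x)).card : ℝ) ≤ lam / (4 * (ℓ + 1)) * (Ss i).card) :
    ∃ R : Fin ℓ → Finset V, (∀ i, R i ⊆ Ss i) ∧ (∀ i, ((Ss i).card : ℝ) ≤ 2 * (R i).card) ∧
      ∀ i j, i < j →
        (∀ v ∈ R i, (((R j).filter (fun x => E x v)).card : ℝ) ≤ lam * (R j).card) ∧
        (∀ v ∈ R j, (((R i).filter (fun x => E v x)).card : ℝ) ≤ lam * (R i).card) := by
  classical
  let B : Fin ℓ → Fin ℓ → Finset V := fun i j =>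
    (Ss i).filter (fun v => lam / 2 * (Ss j).card < (((Ss j).filter (fun x => E x v)).card : ℝ))
  let R : Fin ℓ → Finset V := fun i => Ss i \ (univ.filter (fun j => i < j)).biUnion (B i)
  have hB : ∀ i j, i < j → ((B i j).card : ℝ) ≤ (Ss i).card / (2 * (ℓ + 1)) := fun i j hij => by
    have := card_filter_lt_degree_mul_le E (Ss j) (Ss i) (b := lam / 2) (hne j) (h i j hij)
    rw [le_div_iff₀ (by positivity)]
    change ((B i j).card : ℝ) * (lam / 2) ≤ _ at this
    rw [div_mul_eq_mul_div, le_div_iff₀ (by positivity)] at this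
    refine le_of_mul_le_mul_left ?_ hlam
    calc _ = ((B i j).card : ℝ) * (lam / 2) * (4 * (ℓ + 1)) := by ring
      _ ≤ _ := this
  have hRsub : ∀ i, R i ⊆ Ss i := fun i => sdiff_subset
  have hRcard : ∀ i, ((Ss i).card : ℝ) ≤ 2 * (R i).card := fun i => by
    have h1 : ((Ss i).card : ℝ) ≤ (R i).card
        + ((univ.filter (fun j => i < j)).biUnion (B i)).card := by
      exact_mod_cast card_le_card_sdiff_add_card
    have h2 : (((univ.filter (fun j => i < j)).biUnion (B i)).card : ℝ)
        ≤ ∑ j ∈ univ.filter (fun j => i < j), ((B i j).card : ℝ) := by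
      exact_mod_cast card_biUnion_le
    have h3 : ∑ j ∈ univ.filter (fun j => i < j), ((B i j).card : ℝ)
        ≤ (univ.filter (fun j => i < j)).card * ((Ss i).card / (2 * (ℓ + 1))) := by
      simpa only [nsmul_eq_mul] using Finset.sum_le_card_nsmul _ _ _
        (fun j hj => hB i j (mem_filter.mp hj).2)
    have h4 : ((univ.filter (fun j => i < j)).card : ℝ) ≤ ℓ := by
      exact_mod_cast (card_filter_le _ _).trans (by simp)
    have h5 : (ℓ : ℝ) * ((Ss i).card / (2 * (ℓ + 1))) ≤ (Ss i).card / 2 := by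
      rw [mul_div_assoc', div_le_div_iff₀ (by positivity) (by positivity)]
      nlinarith [(Nat.cast_nonneg (Ss i).card : (0 : ℝ) ≤ _)]
    have h6 := mul_le_mul_of_nonneg_right h4
      (show (0 : ℝ) ≤ (Ss i).card / (2 * (ℓ + 1)) by positivity)
    linarith
  have hmono : ∀ i (p : V → Prop) [DecidablePred p],
      (((R i).filter p).card : ℝ) ≤ ((Ss i).filter p).card := fun i p _ => by
    exact_mod_cast card_le_card (filter_subset_filter _ (hRsub i))
  refine ⟨R, hRsub, hRcard, fun i j hij => ⟨fun v hv => ?_, fun v hv => ?_⟩⟩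
  · have h1 : ¬ lam / 2 * (Ss j).card < (((Ss j).filter (fun x => E x v)).card : ℝ) := fun hlt =>
      (mem_sdiff.mp hv).2 (mem_biUnion.mpr
        ⟨j, by simpa using hij, mem_filter.mpr ⟨hRsub i hv, hlt⟩⟩)
    have h2 := hmono j (fun x => E x v)
    nlinarith [hRcard j]
  · have h1 := h i j hij v (hRsub j hv)
    have h2 := hmono i (fun x => E v x)
    have h3 : lam / (4 * ((ℓ : ℝ) + 1)) ≤ lam / 2 := by
      gcongr
      nlinarith [(Nat.cast_nonneg ℓ : (0 : ℝ) ≤ _)]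
    have h4 := mul_le_mul_of_nonneg_right h3 (Nat.cast_nonneg (Ss i).card : (0 : ℝ) ≤ _)
    nlinarith [hRcard i]

/-- If the largest transitive subset of a tournament has size less than `|V| ^ ε`, then
`2 < |V| ^ ε`. -/
lemma two_lt_card_rpow {V : Type} [Fintype V] [DecidableEq V] {E : V → V → Prop}
    (hirr : ∀ v : V, ¬ E v v) (hasymm : ∀ u v : V, E u v → ¬ E v u) {ε : ℝ} (hε : 0 < ε)
    (htr : (trSub E (univ : Finset V) : ℝ) < (Fintype.card V : ℝ) ^ ε) :
    2 < (Fintype.card V : ℝ) ^ ε := by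
  rcases Nat.lt_or_ge 1 (Fintype.card V) with h | h
  · obtain ⟨a, b, hab⟩ := Fintype.exists_pair_of_one_lt_card h
    have hT : IsTransOn E {a, b} := by
      intro x hx y hy z hz hxy hyz
      simp only [mem_insert, mem_singleton] at hx hy hz
      rcases hx with rfl | rfl <;> rcases hy with rfl | rfl <;> rcases hz with rfl | rfl <;>
        first
        | assumption
        | exact absurd hyz (hasymm _ _ hxy)
    have := card_le_trSub (subset_univ _) hT
    rw [card_pair hab] at this
    exact lt_of_le_of_lt (by exact_mod_cast this) htr
  · exfalso
    rcases Nat.le_one_iff_eq_zero_or_eq_one.mp h with h0 | h1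
    · rw [h0, Nat.cast_zero, Real.zero_rpow hε.ne'] at htr
      exact absurd htr (not_lt.mpr (Nat.cast_nonneg _))
    · have hT : IsTransOn E (univ : Finset V) := by
        intro x _ y _ z _ hxy _
        have : Subsingleton V := Fintype.card_le_one_iff_subsingleton.mp h
        exact absurd (Subsingleton.elim x y ▸ hxy) (hirr _)
      have := card_le_trSub (subset_univ _) hT
      rw [card_univ, h1] at this
      rw [h1, Nat.cast_one, Real.one_rpow] at htr
      exact absurd htr (not_lt.mpr (by exact_mod_cast this))

end

/-- For every tournament `S`, every `{0,1}`-vector `w` of length `ℓ`, and every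
`0 < λ < 1/2`, there exist `ε, c > 0` such that every `S`-free `ε`-critical
tournament contains a smooth `(c, λ, w)`-structure. -/
theorem smooth_structure_in_critical
    (VS : Type) [Fintype VS] (ES : VS → VS → Prop)
    (hSirr : ∀ v : VS, ¬ ES v v)
    (hStot : ∀ u v : VS, u ≠ v → (ES u v ↔ ¬ ES v u))
    (ℓ : ℕ) (w : Fin ℓ → Fin 2)
    (lam : ℝ) (hlam0 : 0 < lam) (hlam : lam < 1/2) :
    ∃ ε c : ℝ, 0 < ε ∧ 0 < c ∧
      ∀ (V : Type) [Fintype V] [DecidableEq V] (E : V → V → Prop) [DecidableRel E],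
        (∀ v : V, ¬ E v v) →
        (∀ u v : V, u ≠ v → (E u v ↔ ¬ E v u)) →
        -- `S`-free:
        (¬ ∃ f : VS → V, Function.Injective f ∧ ∀ u v : VS, ES u v → E (f u) (f v)) →
        -- `ε`-critical:
        ((trSub E (Finset.univ : Finset V) : ℝ) < (Fintype.card V : ℝ) ^ ε) →
        (∀ W : Finset V, W ⊂ Finset.univ → ((W.card : ℝ) ^ ε ≤ (trSub E W : ℝ))) →
        -- there is a smooth `(c, lam, w)`-structure:
        ∃ Ss : Fin ℓ → Finset V,
          (∀ i j : Fin ℓ, i ≠ j → Disjoint (Ss i) (Ss j)) ∧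
          (∀ i : Fin ℓ, w i = 0 → c * (Fintype.card V : ℝ) ≤ ((Ss i).card : ℝ)) ∧
          (∀ i : Fin ℓ, w i = 1 →
            IsTransOn E (Ss i) ∧
            c * (trSub E (Finset.univ : Finset V) : ℝ) ≤ ((Ss i).card : ℝ)) ∧
          (∀ i j : Fin ℓ, i < j →
            (∀ v ∈ Ss i,
              ((((Ss j).filter (fun x => E x v)).card : ℝ) ≤ lam * ((Ss j).card : ℝ))) ∧
            (∀ v ∈ Ss j,
              ((((Ss i).filter (fun x => E v x)).card : ℝ) ≤ lam * ((Ss i).card : ℝ)))) := by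
  have hSasymm : ∀ u v : VS, ES u v → ¬ ES v u := fun u v huv =>
    (hStot u v (fun h => hSirr v (h ▸ huv))).mp huv
  obtain ⟨c, N, hc, hc1, H⟩ := exists_one_sided_structure VS ES hSirr hSasymm
    (show 0 < lam / (4 * ((ℓ : ℝ) + 1)) by positivity) ℓ w
  have hM : (2 : ℝ) ≤ max 2 N := le_max_left _ _
  set M := max 2 N
  have hε : 0 < Real.logb M 2 := Real.logb_pos (by linarith) (by norm_num)
  have hε1 : Real.logb M 2 ≤ 1 := by
    rw [Real.logb_le_iff_le_rpow (by linarith) (by norm_num), Real.rpow_one]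
    exact hM
  have hMε : M ^ Real.logb M 2 = 2 := Real.rpow_logb (by linarith) (by linarith) (by norm_num)
  set ε := Real.logb M 2
  refine ⟨ε, c / 2, hε, by positivity, ?_⟩
  intro V _ _ E _ hirr htot hfree htr hcrit
  have hasymm : ∀ u v : V, E u v → ¬ E v u := fun u v huv =>
    (htot u v (fun h => hirr v (h ▸ huv))).mp huv
  have htwo := two_lt_card_rpow hirr hasymm hε htr
  have hMcard : M < Fintype.card V := by
    by_contra! hle
    have := Real.rpow_le_rpow (Nat.cast_nonneg _) hle hε.le
    linarith
  have hVpos : (0 : ℝ) < Fintype.card V := by linarith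
  have hVne : (Finset.univ : Finset V).Nonempty := by
    rw [← Finset.card_pos, Finset.card_univ]
    exact_mod_cast hVpos
  obtain ⟨Ss, -, hdisj, hS0, hS1, hS⟩ := H V E hfree ε hε hcrit Finset.univ hVne
    (by rw [Finset.card_univ]; exact (le_max_right _ _).trans hMcard.le)
  rw [Finset.card_univ] at hS0 hS1
  have hne : ∀ i, (Ss i).Nonempty := fun i => by
    rw [← Finset.card_pos]
    have : (0 : ℝ) < (Ss i).card := by
      rcases (by omega : w i = 0 ∨ w i = 1) with hi | hi
      · exact lt_of_lt_of_le (by positivity) (hS0 i hi)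
      · exact lt_of_lt_of_le (by positivity) (hS1 i hi).2
    exact_mod_cast this
  obtain ⟨R, hRS, hRc, hR⟩ := exists_two_sided_structure E Ss hne hlam0 hS
  refine ⟨R, fun i j hij => (hdisj i j hij).mono (hRS i) (hRS j), fun i hi => ?_,
    fun i hi => ⟨?_, ?_⟩, hR⟩
  · linarith [hS0 i hi, hRc i]
  · exact fun a ha b hb d hd => (hS1 i hi).1 a (hRS i ha) b (hRS i hb) d (hRS i hd)
  · have h1 := (hS1 i hi).2
    rw [Real.mul_rpow hc.le hVpos.le] at h1
    have h2 : c ≤ c ^ ε := by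
      simpa using Real.rpow_le_rpow_of_exponent_ge hc hc1 hε1
    have h3 : c * (trSub E Finset.univ : ℝ) ≤ c ^ ε * (Fintype.card V : ℝ) ^ ε :=
      mul_le_mul h2 htr.le (Nat.cast_nonneg _) (by positivity)
    linarith [hRc i]
end

section
/- Let D be an outsimplicial directed graph, let ~ be the equivalence relation of mutual reachability on V(D) (u ~ v iff u reaches v and v reaches u), and let F be the condensation of D: the digraph on the equivalence classes of ~ in which, for distinct classes C and C', there is an edge from C to C' iff some vertex of C has an edge in D to some vertex of C'. Then F is outsimplicial: for any classes C, C₁, C₂ with C₁ ≠ C₂ such that F has edges from C to C₁ and from C to C₂, F has an edge between C₁ and C₂ in some direction. -/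
/-- In an outsimplicial digraph, an edge `u → v` can be transported along any path from `u` to a
vertex `w` that is not reachable from `v`. -/
theorem edge_of_reflTransGen_of_not_reflTransGen {V : Type*} {E : V → V → Prop}
    (hout : ∀ u v w : V, v ≠ w → E u v → E u w → E v w ∨ E w v)
    {u v w : V} (huv : E u v) (huw : Relation.ReflTransGen E u w)
    (hvw : ¬ Relation.ReflTransGen E v w) : E w v := by
  induction huw with
  | refl => exact huv
  | @tail b c _ hbc ih =>
    have hbv : E b v := ih fun h => hvw (h.tail hbc)
    have hne : v ≠ c := by
      rintro rfl
      exact hvw .refl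
    exact (hout b v c hne hbv hbc).resolve_left fun h => hvw (.single h)

/-- The condensation of an outsimplicial digraph is outsimplicial.
Classes of mutual reachability are sets of the form
`{y | x reaches y and y reaches x}`; `F` has an edge from class `C` to class `C'`
iff `C ≠ C'` and some vertex of `C` has a `D`-edge to some vertex of `C'`. -/
theorem condensation_outsimplicial
    (V : Type) [Fintype V] (E : V → V → Prop)
    (hirr : ∀ v : V, ¬ E v v)
    (hout : ∀ u v w : V, v ≠ w → E u v → E u w → E v w ∨ E w v)
    (C C₁ C₂ : Set V)
    (hC : ∃ x : V, C = {y | Relation.ReflTransGen E x y ∧ Relation.ReflTransGen E y x})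
    (hC₁ : ∃ x : V, C₁ = {y | Relation.ReflTransGen E x y ∧ Relation.ReflTransGen E y x})
    (hC₂ : ∃ x : V, C₂ = {y | Relation.ReflTransGen E x y ∧ Relation.ReflTransGen E y x})
    (hne : C₁ ≠ C₂)
    (h1 : C ≠ C₁ ∧ ∃ u ∈ C, ∃ v ∈ C₁, E u v)
    (h2 : C ≠ C₂ ∧ ∃ u ∈ C, ∃ v ∈ C₂, E u v) :
    (C₁ ≠ C₂ ∧ ∃ u ∈ C₁, ∃ v ∈ C₂, E u v) ∨
    (C₂ ≠ C₁ ∧ ∃ u ∈ C₂, ∃ v ∈ C₁, E u v) := by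
  obtain ⟨x, rfl⟩ := hC
  obtain ⟨x₁, rfl⟩ := hC₁
  obtain ⟨x₂, rfl⟩ := hC₂
  obtain ⟨hne₁, u₁, hu₁, v₁, hv₁, h₁⟩ := h1
  obtain ⟨-, u₂, hu₂, v₂, hv₂, h₂⟩ := h2
  have class_eq : ∀ {a b : V}, Relation.ReflTransGen E a b → Relation.ReflTransGen E b a →
      {y | Relation.ReflTransGen E a y ∧ Relation.ReflTransGen E y a} =
        {y | Relation.ReflTransGen E b y ∧ Relation.ReflTransGen E y b} := fun hab hba =>
    Set.ext fun _ => ⟨fun h => ⟨hba.trans h.1, h.2.trans hab⟩,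
      fun h => ⟨hab.trans h.1, h.2.trans hba⟩⟩
  have hvu : ¬ Relation.ReflTransGen E v₁ u₂ := fun h =>
    hne₁ (class_eq ((hu₁.1.tail h₁).trans hv₁.2) (hv₁.1.trans (h.trans hu₂.2)))
  have h₂₁ : E u₂ v₁ :=
    edge_of_reflTransGen_of_not_reflTransGen hout h₁ (hu₁.2.trans hu₂.1) hvu
  have hv : v₁ ≠ v₂ := by
    rintro rfl
    exact hne (class_eq (hv₁.1.trans hv₂.2) (hv₂.1.trans hv₁.2))
  exact (hout u₂ v₁ v₂ hv h₂₁ h₂).imp (fun h => ⟨hne, v₁, hv₁, v₂, hv₂, h⟩)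
    (fun h => ⟨hne.symm, v₂, hv₂, v₁, hv₁, h⟩)
end

section
/- Let D be an outsimplicial directed graph with no directed cycle (i.e., no vertex v with a nonempty directed walk from v back to v). Then the underlying undirected graph of D is chordal; explicitly, there is no k ≥ 4 and sequence of distinct vertices v₀, v₁, ..., v_{k-1} such that consecutive vertices (cyclically, including v_{k-1} and v₀) are joined by an edge of D in some direction while no two non-consecutive vertices in the sequence are joined by an edge of D in either direction. -/
/-- In an acyclic relation on a nonempty finite type, some element has no predecessor. -/
theorem exists_source_of_acyclic {α : Type*} [Finite α] [Nonempty α] {r : α → α → Prop}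
    (hr : ¬ ∃ a, Relation.TransGen r a a) : ∃ a, ∀ b, ¬ r b a := by
  have : Std.Irrefl (Relation.TransGen r) := ⟨fun a ha => hr ⟨a, ha⟩⟩
  obtain ⟨a, -, ha⟩ :=
    (Finite.wellFounded_of_trans_of_irrefl (Relation.TransGen r)).has_min Set.univ
      Set.univ_nonempty
  exact ⟨a, fun b hb => ha b trivial (.single hb)⟩

/-- If `D` is an outsimplicial digraph with no directed cycle, then the underlying
undirected graph of `D` is chordal: there is no induced cycle of length `k ≥ 4`
(here `k = m + 4`). Consecutive vertices (cyclically) are joined by an edge in some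
direction, and non-consecutive vertices are joined in neither direction. -/
theorem outsimplicial_acyclic_chordal
    (V : Type) [Fintype V] (E : V → V → Prop)
    (hirr : ∀ v : V, ¬ E v v)
    (hout : ∀ u v w : V, v ≠ w → E u v → E u w → E v w ∨ E w v)
    (hacyc : ¬ ∃ v : V, Relation.TransGen E v v) :
    ¬ ∃ (m : ℕ) (v : Fin (m + 4) → V),
        Function.Injective v ∧
        (∀ i : Fin (m + 4), E (v i) (v (i + 1)) ∨ E (v (i + 1)) (v i)) ∧
        (∀ i j : Fin (m + 4), j ≠ i → j ≠ i + 1 → i ≠ j + 1 →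
          ¬ (E (v i) (v j) ∨ E (v j) (v i))) := by
  rintro ⟨m, v, hinj, hadj, hnon⟩
  obtain ⟨j, hj⟩ := exists_source_of_acyclic (r := fun a b => E (v a) (v b)) fun ⟨a, ha⟩ =>
    hacyc ⟨v a, ha.lift v fun _ _ h => h⟩
  obtain ⟨i, rfl⟩ : ∃ i, j = i + 1 := ⟨j - 1, (sub_add_cancel j 1).symm⟩
  have hval (k : Fin (m + 4)) : (k + 1).val = if k.val = m + 3 then 0 else k.val + 1 := by
    simp [Fin.val_add_one, Fin.ext_iff]
  have hprev : E (v (i + 1)) (v i) := (hadj i).resolve_left (hj i)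
  have hnext : E (v (i + 1)) (v (i + 1 + 1)) := (hadj (i + 1)).resolve_right (hj _)
  have hne : i + 1 + 1 ≠ i := by grind
  have hne' : i + 1 + 1 ≠ i + 1 := by grind
  have hne'' : i ≠ i + 1 + 1 + 1 := by grind
  exact hnon i (i + 1 + 1) hne hne' hne'' (hout _ _ _ (hinj.ne hne.symm) hprev hnext)
end

section
/- Let D be a directed graph on a finite vertex set and let W be a subset of its vertices with |W| = m ≥ 2, such that for all distinct u, v ∈ W, either u reaches v or v reaches u. Then there exist disjoint subsets A, B ⊆ W with |A| ≥ ⌊m/2⌋ and |B| ≥ ⌈m/2⌉ such that every vertex of A reaches every vertex of B. -/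
/-- A nonempty finset on which a transitive relation is total has a least element. -/
theorem Finset.exists_rel_forall_of_total {α : Type*} {r : α → α → Prop}
    (htrans : ∀ a b c, r a b → r b c → r a c) {s : Finset α} (hs : s.Nonempty)
    (htotal : ∀ a ∈ s, ∀ b ∈ s, r a b ∨ r b a) : ∃ a ∈ s, ∀ b ∈ s, r a b := by
  induction hs using Finset.Nonempty.cons_induction with
  | singleton a =>
    exact ⟨a, by simp, by simpa using htotal a (by simp) a (by simp)⟩
  | cons a s ha hs ih =>
    simp only [Finset.mem_cons] at htotal ⊢
    obtain ⟨c, hc, hcs⟩ := ih fun x hx y hy => htotal x (.inr hx) y (.inr hy)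
    rcases htotal a (.inl rfl) c (.inr hc) with hac | hca
    · refine ⟨a, .inl rfl, ?_⟩
      rintro b (rfl | hb)
      · simpa using htotal b (.inl rfl) b (.inl rfl)
      · exact htrans _ _ _ hac (hcs b hb)
    · refine ⟨c, .inr hc, ?_⟩
      rintro b (rfl | hb)
      · exact hca
      · exact hcs b hb

/-- A finset on which a transitive relation is total has an initial segment of every
possible size. -/
theorem Finset.exists_subset_card_eq_rel_sdiff {α : Type*} [DecidableEq α] {r : α → α → Prop}
    (htrans : ∀ a b c, r a b → r b c → r a c) {s : Finset α}
    (htotal : ∀ a ∈ s, ∀ b ∈ s, r a b ∨ r b a) {k : ℕ} (hk : k ≤ s.card) :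
    ∃ t ⊆ s, t.card = k ∧ ∀ a ∈ t, ∀ b ∈ s \ t, r a b := by
  induction k with
  | zero => exact ⟨∅, by simp⟩
  | succ k ih =>
    obtain ⟨t, hts, rfl, ht⟩ := ih (by omega)
    have hne : (s \ t).Nonempty := by
      rw [← Finset.card_pos, Finset.card_sdiff_of_subset hts]
      omega
    obtain ⟨c, hc, hcmin⟩ := Finset.exists_rel_forall_of_total htrans hne
      fun a ha b hb => htotal a (Finset.sdiff_subset ha) b (Finset.sdiff_subset hb)
    obtain ⟨hcs, hct⟩ := Finset.mem_sdiff.mp hc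
    refine ⟨insert c t, Finset.insert_subset hcs hts, Finset.card_insert_of_notMem hct, ?_⟩
    intro a ha b hb
    have hb' : b ∈ s \ t := Finset.sdiff_subset_sdiff le_rfl (Finset.subset_insert c t) hb
    rcases Finset.mem_insert.mp ha with rfl | ha
    · exact hcmin b hb'
    · exact ht a ha b hb'


/-- If `W` is a set of `m ≥ 2` vertices of a digraph such that any two distinct
vertices of `W` are comparable under reachability, then `W` can be split into
disjoint `A, B ⊆ W` with `|A| ≥ ⌊m/2⌋` and `|B| ≥ ⌈m/2⌉` such that every vertex
of `A` reaches every vertex of `B`. -/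
theorem reachability_split
    (V : Type) [Fintype V] (E : V → V → Prop)
    (hirr : ∀ v : V, ¬ E v v)
    (W : Finset V) (m : ℕ) (hWcard : W.card = m) (hm : 2 ≤ m)
    (hcomp : ∀ u ∈ W, ∀ v ∈ W, u ≠ v →
      Relation.ReflTransGen E u v ∨ Relation.ReflTransGen E v u) :
    ∃ A B : Finset V, A ⊆ W ∧ B ⊆ W ∧ Disjoint A B ∧
      m / 2 ≤ A.card ∧ (m + 1) / 2 ≤ B.card ∧
      ∀ a ∈ A, ∀ b ∈ B, Relation.ReflTransGen E a b := by
  classical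
  have htotal : ∀ u ∈ W, ∀ v ∈ W, Relation.ReflTransGen E u v ∨ Relation.ReflTransGen E v u := by
    intro u hu v hv
    by_cases huv : u = v
    · exact .inl (huv ▸ .refl)
    · exact hcomp u hu v hv huv
  obtain ⟨A, hAW, hA, hreach⟩ := Finset.exists_subset_card_eq_rel_sdiff (r := Relation.ReflTransGen E)
    (fun _ _ _ hab hbc => Relation.ReflTransGen.trans hab hbc) htotal (k := m / 2) (by omega)
  refine ⟨A, W \ A, hAW, Finset.sdiff_subset, Finset.disjoint_sdiff, hA.ge, ?_, hreach⟩
  rw [Finset.card_sdiff_of_subset hAW]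
  omega
end

section
/- Let T be a C5-free tournament, and let V₁, ..., V₅ be pairwise disjoint nonempty subsets of V(T) such that for all 1 ≤ i < j ≤ 5, every vertex of V_i has at most |V_j|/5 inneighbors in V_j and every vertex of V_j has at most |V_i|/5 outneighbors in V_i. Define a directed graph D on vertex set V₁ by putting an edge from u to v iff u→v in T and u, v have a common inneighbor in V₅ (some w ∈ V₅ with w→u and w→v). Then D is outsimplicial: for all u, v, w ∈ V₁ with D-edges from u to v and from u to w and v ≠ w, the vertices v and w have a common inneighbor in V₅ (so there is a D-edge between v and w in some direction). -/
/-- Four subsets of a nonempty finite set, each containing at most a fifth of it,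
do not cover it. -/
lemma exists_mem_avoiding_four {α : Type*} [DecidableEq α] {S A B C D : Finset α}
    (hS : S.Nonempty) (hA : (A.card : ℝ) ≤ (S.card : ℝ) / 5)
    (hB : (B.card : ℝ) ≤ (S.card : ℝ) / 5) (hC : (C.card : ℝ) ≤ (S.card : ℝ) / 5)
    (hD : (D.card : ℝ) ≤ (S.card : ℝ) / 5) :
    ∃ z ∈ S, z ∉ A ∧ z ∉ B ∧ z ∉ C ∧ z ∉ D := by
  by_contra! h
  have hsub : S ⊆ (A ∪ B) ∪ (C ∪ D) := by
    intro z hz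
    have := h z hz
    simp only [Finset.mem_union]
    tauto
  have hcard : S.card ≤ (A.card + B.card) + (C.card + D.card) :=
    (Finset.card_le_card hsub).trans <| (Finset.card_union_le _ _).trans <|
      add_le_add (Finset.card_union_le _ _) (Finset.card_union_le _ _)
  have hcard' : (S.card : ℝ) ≤ (A.card + B.card) + (C.card + D.card) := by
    exact_mod_cast hcard
  have hpos : (0 : ℝ) < S.card := by exact_mod_cast hS.card_pos
  linarith

/-- Ten arcs arranged as in `C₅` give a copy of `C₅` in an irreflexive relation. -/
lemma exists_injective_C5_hom {V : Type*} {E : V → V → Prop} (hirr : ∀ v : V, ¬ E v v)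
    {z c d a b : V} (hzc : E z c) (hzd : E z d) (hcd : E c d) (hca : E c a) (hda : E d a)
    (hdb : E d b) (hab : E a b) (haz : E a z) (hbz : E b z) (hbc : E b c) :
    ∃ f : Fin 5 → V, Function.Injective f ∧ ∀ i j : Fin 5, C5 i j → E (f i) (f j) := by
  have hhom : ∀ i j : Fin 5, C5 i j → E (![z, c, d, a, b] i) (![z, c, d, a, b] j) := by
    rintro i j (rfl | rfl) <;> fin_cases i <;> assumption
  refine ⟨![z, c, d, a, b], fun i j hij => ?_, hhom⟩
  have hadj : ∀ i j : Fin 5, i = j ∨ C5 i j ∨ C5 j i := by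
    unfold C5
    decide
  rcases hadj i j with h | h | h
  · exact h
  · have := hhom i j h
    rw [hij] at this
    exact (hirr _ this).elim
  · have := hhom j i h
    rw [hij] at this
    exact (hirr _ this).elim

/-- In a `C₅`-free tournament with a smooth structure `V₁,…,V₅` (here `Vs 0,…,Vs 4`),
the digraph `D` on `V₁` — with an edge `u → v` iff `u → v` in `T` and `u, v` have a
common inneighbor in `V₅` — is outsimplicial: any two distinct `D`-outneighbors
`v, w` of `u` have a common inneighbor in `V₅`. -/
theorem auxiliary_digraph_outsimplicial
    (V : Type) [Fintype V] [DecidableEq V] (E : V → V → Prop) [DecidableRel E]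
    (hirr : ∀ v : V, ¬ E v v)
    (htot : ∀ u v : V, u ≠ v → (E u v ↔ ¬ E v u))
    (hC5free : ¬ ∃ f : Fin 5 → V, Function.Injective f ∧
        ∀ i j : Fin 5, C5 i j → E (f i) (f j))
    (Vs : Fin 5 → Finset V)
    (hdisj : ∀ i j : Fin 5, i ≠ j → Disjoint (Vs i) (Vs j))
    (hne : ∀ i : Fin 5, (Vs i).Nonempty)
    (hsmooth : ∀ i j : Fin 5, i < j →
      (∀ v ∈ Vs i,
        ((((Vs j).filter (fun x => E x v)).card : ℝ) ≤ ((Vs j).card : ℝ) / 5)) ∧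
      (∀ v ∈ Vs j,
        ((((Vs i).filter (fun x => E v x)).card : ℝ) ≤ ((Vs i).card : ℝ) / 5))) :
    ∀ u ∈ Vs 0, ∀ v ∈ Vs 0, ∀ w ∈ Vs 0, v ≠ w →
      (E u v ∧ ∃ x ∈ Vs 4, E x u ∧ E x v) →
      (E u w ∧ ∃ x ∈ Vs 4, E x u ∧ E x w) →
      ∃ x ∈ Vs 4, E x v ∧ E x w := by
  intro u hu v hv w hw _ ⟨huv, x, hx, hxu, hxv⟩ ⟨huw, y, hy, hyu, hyw⟩
  by_contra! hno
  have hne' : ∀ {i j : Fin 5}, i ≠ j → ∀ {a b : V}, a ∈ Vs i → b ∈ Vs j → a ≠ b :=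
    fun hij _ _ ha hb => Finset.disjoint_iff_ne.mp (hdisj _ _ hij) _ ha _ hb
  have hrev : ∀ {a b : V}, a ≠ b → ¬ E b a → E a b := fun hab h => (htot _ _ hab).mpr h
  have hcycle : ∀ b ∈ Vs 0, ∀ c ∈ Vs 4, ∀ d ∈ Vs 4,
      E u b → E c u → E d u → E d b → E b c → ¬ E c d := by
    intro b hb c hc d hd hub hcu hdu hdb hbc hcd
    obtain ⟨z, hz, hzu, hzb, hzc, hzd⟩ := exists_mem_avoiding_four (hne 2)
      ((hsmooth 0 2 (by decide)).1 u hu) ((hsmooth 0 2 (by decide)).1 b hb)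
      ((hsmooth 2 4 (by decide)).2 c hc) ((hsmooth 2 4 (by decide)).2 d hd)
    simp only [Finset.mem_filter, hz, true_and] at hzu hzb hzc hzd
    exact hC5free <| exists_injective_C5_hom hirr
      (hrev (hne' (by decide) hz hc) hzc) (hrev (hne' (by decide) hz hd) hzd) hcd hcu hdu hdb
      hub (hrev (hne' (by decide) hu hz) hzu) (hrev (hne' (by decide) hb hz) hzb) hbc
  have hwx : E w x := hrev (hne' (by decide) hw hx) (hno x hx hxv)
  have hvy : E v y := hrev (hne' (by decide) hv hy) fun h => hno y hy h hyw
  have hxy : x ≠ y := by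
    rintro rfl
    exact hno x hx hxv hyw
  exact hcycle w hw x hx y hy huw hxu hyu hyw hwx <|
    hrev hxy <| hcycle v hv y hy x hx huv hyu hxu hxv hvy
end

section
/- Let T be a C5-free tournament, and let V₁, ..., V₅ be pairwise disjoint nonempty subsets of V(T) such that for all 1 ≤ i < j ≤ 5, every vertex of V_i has at most |V_j|/5 inneighbors in V_j and every vertex of V_j has at most |V_i|/5 outneighbors in V_i. Define a directed graph D on vertex set V₁ by putting an edge from u to v iff u→v in T and u, v have a common inneighbor in V₅. Suppose furthermore that there do not exist sets A ⊆ V₂ and B ⊆ V₄ with |A| ≥ (2/5)·|V₂| and |B| ≥ (2/5)·|V₄| such that A is complete to B in T. Then for every edge (u, v) of D, every vertex of V₃ that is an inneighbor of u in T is also an inneighbor of v in T; that is, N⁻(u) ∩ V₃ ⊆ N⁻(v) ∩ V₃. -/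
/-- Removing from `W ⊆ S` the elements with a property held by at most `c` elements of `S`
decreases the size by at most `c`. -/
theorem card_sub_le_card_filter_not {V : Type*} {S W : Finset V} (p : V → Prop)
    [DecidablePred p] {c : ℝ} (hWS : W ⊆ S) (hp : ((S.filter p).card : ℝ) ≤ c) :
    (W.card : ℝ) - c ≤ ((W.filter (fun x => ¬ p x)).card : ℝ) := by
  have h : ((W.filter p).card : ℝ) + ((W.filter (fun x => ¬ p x)).card : ℝ) = W.card := by
    exact_mod_cast W.card_filter_add_card_filter_not p
  have h' : ((W.filter p).card : ℝ) ≤ (S.filter p).card := by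
    exact_mod_cast Finset.card_le_card (Finset.filter_subset_filter p hWS)
  linarith

/-- Ten edges in the pattern of `C₅` form an injective copy of `C₅` in an oriented graph. -/
theorem exists_injective_C5_of_edges {V : Type*} {E : V → V → Prop} (hirr : ∀ v : V, ¬ E v v)
    {a b c d e : V} (hab : E a b) (hac : E a c) (hbc : E b c) (hbd : E b d) (hcd : E c d)
    (hce : E c e) (hde : E d e) (hda : E d a) (hea : E e a) (heb : E e b) :
    ∃ f : Fin 5 → V, Function.Injective f ∧ ∀ i j : Fin 5, C5 i j → E (f i) (f j) := by
  have key : ∀ i j : Fin 5, C5 i j → E (![a, b, c, d, e] i) (![a, b, c, d, e] j) := by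
    rintro i j (rfl | rfl) <;> fin_cases i <;> assumption
  refine ⟨![a, b, c, d, e], fun i j hij => ?_, key⟩
  have htri : ∀ i j : Fin 5, i = j ∨ (j = i + 1 ∨ j = i + 2) ∨ (i = j + 1 ∨ i = j + 2) := by
    decide
  rcases htri i j with h | h | h
  · exact h
  · exact absurd (hij ▸ key i j h) (hirr _)
  · exact absurd (hij ▸ key j i h) (hirr _)

/-- In a `C₅`-free tournament with a smooth structure `V₁,…,V₅` (here `Vs 0,…,Vs 4`),
if there are no sets `A ⊆ V₂`, `B ⊆ V₄` with `|A| ≥ (2/5)|V₂|`, `|B| ≥ (2/5)|V₄|`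
and `A` complete to `B`, then for every edge `(u,v)` of the auxiliary digraph `D` on
`V₁` (i.e. `u → v` in `T` and `u, v` have a common inneighbor in `V₅`), we have
`N⁻(u) ∩ V₃ ⊆ N⁻(v) ∩ V₃`. -/
theorem auxiliary_digraph_inneighbor_mono
    (V : Type) [Fintype V] [DecidableEq V] (E : V → V → Prop) [DecidableRel E]
    (hirr : ∀ v : V, ¬ E v v)
    (htot : ∀ u v : V, u ≠ v → (E u v ↔ ¬ E v u))
    (hC5free : ¬ ∃ f : Fin 5 → V, Function.Injective f ∧
        ∀ i j : Fin 5, C5 i j → E (f i) (f j))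
    (Vs : Fin 5 → Finset V)
    (hdisj : ∀ i j : Fin 5, i ≠ j → Disjoint (Vs i) (Vs j))
    (hne : ∀ i : Fin 5, (Vs i).Nonempty)
    (hsmooth : ∀ i j : Fin 5, i < j →
      (∀ v ∈ Vs i,
        ((((Vs j).filter (fun x => E x v)).card : ℝ) ≤ ((Vs j).card : ℝ) / 5)) ∧
      (∀ v ∈ Vs j,
        ((((Vs i).filter (fun x => E v x)).card : ℝ) ≤ ((Vs i).card : ℝ) / 5)))
    (hnopair : ¬ ∃ A B : Finset V, A ⊆ Vs 1 ∧ B ⊆ Vs 3 ∧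
        (2 / 5 : ℝ) * ((Vs 1).card : ℝ) ≤ (A.card : ℝ) ∧
        (2 / 5 : ℝ) * ((Vs 3).card : ℝ) ≤ (B.card : ℝ) ∧
        ∀ a ∈ A, ∀ b ∈ B, E a b) :
    ∀ u ∈ Vs 0, ∀ v ∈ Vs 0,
      (E u v ∧ ∃ x ∈ Vs 4, E x u ∧ E x v) →
      ∀ t ∈ Vs 2, E t u → E t v := by
  rintro u hu v hv ⟨huv, x, hx, hxu, hxv⟩ t ht htu
  by_contra hvt'
  have hflip : ∀ {i j : Fin 5} {a b : V}, i ≠ j → a ∈ Vs i → b ∈ Vs j → ¬ E a b → E b a :=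
    fun hij ha hb h => by
      by_contra h'
      exact h ((htot _ _ (Finset.disjoint_left.mp (hdisj _ _ hij) ha |> fun hn he =>
        hn (he ▸ hb))).mpr h')
  have hvt : E v t := hflip (by decide) ht hv hvt'
  have hin : ∀ {i j : Fin 5} {w : V}, i < j → w ∈ Vs i →
      (((Vs j).filter (fun y => E y w)).card : ℝ) ≤ ((Vs j).card : ℝ) / 5 :=
    fun hij hw => (hsmooth _ _ hij).1 _ hw
  have hout : ∀ {i j : Fin 5} {w : V}, i < j → w ∈ Vs j →
      (((Vs i).filter (fun y => E w y)).card : ℝ) ≤ ((Vs i).card : ℝ) / 5 :=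
    fun hij hw => (hsmooth _ _ hij).2 _ hw
  set A₁ := (Vs 1).filter (fun y => ¬ E y u) with hA₁
  set A₂ := A₁.filter (fun y => ¬ E x y) with hA₂
  set A := A₂.filter (fun y => ¬ E t y) with hA
  have sA₁ : A₁ ⊆ Vs 1 := Finset.filter_subset _ _
  have sA₂ : A₂ ⊆ Vs 1 := (Finset.filter_subset _ _).trans sA₁
  have sA : A ⊆ Vs 1 := (Finset.filter_subset _ _).trans sA₂
  have cA₁ := card_sub_le_card_filter_not (fun y => E y u) (Finset.Subset.refl (Vs 1))
    (hin (by decide) hu)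
  have cA₂ := card_sub_le_card_filter_not (fun y => E x y) sA₁ (hout (by decide) hx)
  have cA₃ := card_sub_le_card_filter_not (fun y => E t y) sA₂ (hout (by decide) ht)
  have hAcard : (2 / 5 : ℝ) * ((Vs 1).card : ℝ) ≤ (A.card : ℝ) := by linarith
  have memA : ∀ a ∈ A, E u a ∧ E a x ∧ E a t := fun a ha => by
    have haV := sA ha
    simp only [hA, hA₂, hA₁, Finset.mem_filter] at ha
    exact ⟨hflip (by decide) haV hu ha.1.1.2, hflip (by decide) hx haV ha.1.2,
      hflip (by decide) ht haV ha.2⟩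
  by_cases hxt : E x t
  · set B₁ := (Vs 3).filter (fun y => ¬ E y u) with hB₁
    set B₂ := B₁.filter (fun y => ¬ E x y) with hB₂
    set B := B₂.filter (fun y => ¬ E y t) with hB
    have sB₁ : B₁ ⊆ Vs 3 := Finset.filter_subset _ _
    have sB₂ : B₂ ⊆ Vs 3 := (Finset.filter_subset _ _).trans sB₁
    have sB : B ⊆ Vs 3 := (Finset.filter_subset _ _).trans sB₂
    have cB₁ := card_sub_le_card_filter_not (fun y => E y u) (Finset.Subset.refl (Vs 3))
      (hin (by decide) hu)
    have cB₂ := card_sub_le_card_filter_not (fun y => E x y) sB₁ (hout (by decide) hx)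
    have cB₃ := card_sub_le_card_filter_not (fun y => E y t) sB₂ (hin (by decide) ht)
    refine hnopair ⟨A, B, sA, sB, hAcard, by linarith, fun a ha b hb => ?_⟩
    by_contra hab
    obtain ⟨hua, hax, hat⟩ := memA a ha
    have hbV := sB hb
    have hba : E b a := hflip (by decide) (sA ha) hbV hab
    simp only [hB, hB₂, hB₁, Finset.mem_filter] at hb
    exact hC5free (exists_injective_C5_of_edges hirr
      (hflip (by decide) hbV hu hb.1.1.2) hua hba (hflip (by decide) hx hbV hb.1.2)
      hax hat hxt hxu htu (hflip (by decide) hbV ht hb.2))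
  · have htx : E t x := hflip (by decide) hx ht hxt
    have cA₄ := card_sub_le_card_filter_not (fun y => E y v) sA (hin (by decide) hv)
    have hpos : (0 : ℝ) < (Vs 1).card := by exact_mod_cast (hne 1).card_pos
    have hcard : (0 : ℝ) < (A.filter (fun y => ¬ E y v)).card := by linarith
    obtain ⟨a, ha⟩ := Finset.card_pos.mp (by exact_mod_cast hcard)
    rw [Finset.mem_filter] at ha
    obtain ⟨hua, hax, hat⟩ := memA a ha.1
    exact hC5free (exists_injective_C5_of_edges hirr huv hua
      (hflip (by decide) (sA ha.1) hv ha.2) hvt hat hax htx htu hxu hxv)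
end
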